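/- arXiv:1905.06107 — 3 statements merged into one kernel-verified Lean document; each statement's English description precedes it below -/
import Mathlib

section
/- Fix $n \ge 3$ and $a \in (0,1)$. There exists $d_0 > 0$ such that for every $d \in (0, d_0)$: the set $S$ of $n$-periodic stationary solutions of the lattice Nagumo equation (sequences $u : \mathbb{Z} \to \mathbb{R}$ with $u_{i+n} = u_i$ and $d(u_{i-1} - 2u_i + u_{i+1}) + g(u_i;a) = 0$ for all $i$) has exactly $3^n$ elements, the group $\mathbb{Z}/n\mathbb{Z}$ acts on $S$ by translations $(\mathcal{T}_\ell u)_i = u_{i+\ell}$, the number of orbits of this action equals $N_3(n) = \frac{1}{n}\sum_{d' \mid n}\varphi(d')3^{n/d'}$, and exactly $L_3(n) = \frac{1}{n}\sum_{d' \mid n}\mu(d')3^{n/d'}$ of these orbits consist of solutions whose minimal period is exactly $n$. -/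
/-- The cubic bistable nonlinearity `g(u; a) = u(1-u)(u-a)`. -/
noncomputable def g (a u : ℝ) : ℝ := u * (1 - u) * (u - a)

/-- The set of `n`-periodic stationary solutions of the lattice Nagumo equation. -/
noncomputable def PerStat (n : ℕ) (a d : ℝ) : Set (ℤ → ℝ) :=
  {u : ℤ → ℝ | (∀ i : ℤ, u (i + n) = u i) ∧
    ∀ i : ℤ, d * (u (i - 1) - 2 * u i + u (i + 1)) + g a (u i) = 0}

/-- The elementary translation relation on `n`-periodic stationary solutions:
`v` is the shift of `u` by one position. The quotient `Quot (TransRel n a d)`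
identifies solutions in the same orbit of the translation action. -/
def TransRel (n : ℕ) (a d : ℝ) (u v : PerStat n a d) : Prop :=
  ∀ i : ℤ, (v : ℤ → ℝ) i = (u : ℤ → ℝ) (i + 1)

/-- A sequence has minimal period exactly `n` if it is `n`-periodic and no smaller
positive integer is a period. -/
def MinPeriodExact (n : ℕ) (u : ℤ → ℝ) : Prop :=
  (∀ i : ℤ, u (i + n) = u i) ∧ ∀ m : ℕ, 0 < m → (∀ i : ℤ, u (i + m) = u i) → n ≤ m

/-- Three-letter colourings of the cycle `ZMod n`. -/
abbrev CycleColoring (n : ℕ) : Type := ZMod n → Fin 3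

/-- Rotation of colourings: `(k +ᵥ f) i = f (i + k)`. -/
instance rotationAction (n : ℕ) : AddAction (ZMod n) (CycleColoring n) where
  vadd k f := fun i => f (i + k)
  zero_vadd f := funext fun i => congrArg f (add_zero i)
  add_vadd k l f := funext fun i => congrArg f (by ring)

theorem rotation_vadd_apply {n : ℕ} (k : ZMod n) (f : CycleColoring n) (i : ZMod n) :
    (k +ᵥ f) i = f (i + k) := rfl

theorem card_rotation_fixedBy {n : ℕ} [NeZero n] (k : ZMod n) :
    Nat.card (AddAction.fixedBy (CycleColoring n) k) = 3 ^ (n / addOrderOf k) := by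
  have hfix (f : CycleColoring n) (hf : k +ᵥ f = f) (x : ZMod n)
      (hx : x ∈ AddSubgroup.zmultiples k) : x +ᵥ f = f := by
    have hle : AddSubgroup.zmultiples k ≤ AddAction.stabilizer (ZMod n) f := by
      rw [AddSubgroup.zmultiples_le]
      exact hf
    exact hle hx
  let e : AddAction.fixedBy (CycleColoring n) k ≃
      (ZMod n ⧸ AddSubgroup.zmultiples k → Fin 3) :=
    { toFun := fun f => Quotient.lift f.1 fun x y hxy => by
        have h := hfix f.1 f.2 _ (QuotientAddGroup.leftRel_apply.1 hxy)
        have h' := congrFun h x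
        rw [rotation_vadd_apply] at h'
        rw [← h']
        exact congrArg f.1 (by abel)
      invFun := fun h => ⟨fun i => h (QuotientAddGroup.mk i), funext fun i => by
        rw [rotation_vadd_apply]
        congr 1
        rw [eq_comm, QuotientAddGroup.eq]
        simp⟩
      left_inv := fun f => rfl
      right_inv := fun h => funext fun q => Quotient.inductionOn q fun _ => rfl }
  have hcard := AddSubgroup.card_eq_card_quotient_mul_card_addSubgroup (AddSubgroup.zmultiples k)
  rw [Nat.card_zmod, Nat.card_zmultiples] at hcard
  rw [Nat.card_congr e, Nat.card_fun, Nat.card_fin,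
    Nat.eq_div_of_mul_eq_left (addOrderOf_pos k).ne' hcard.symm]

/-- The number of rotation classes of colourings, by Burnside's lemma. -/
theorem mul_card_rotation_orbits {n : ℕ} [NeZero n] :
    n * Nat.card (AddAction.orbitRel.Quotient (ZMod n) (CycleColoring n)) =
      ∑ m ∈ n.divisors, Nat.totient m * 3 ^ (n / m) := by
  classical
  have hB := AddAction.sum_card_fixedBy_eq_card_orbits_mul_card_addGroup
    (ZMod n) (CycleColoring n)
  simp only [← Nat.card_eq_fintype_card, card_rotation_fixedBy, Nat.card_zmod] at hB
  rw [mul_comm, AddAction.orbitRel.Quotient, ← hB]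
  have hmaps : ∀ k ∈ (Finset.univ : Finset (ZMod n)), addOrderOf k ∈ n.divisors := fun k _ => by
    rw [Nat.mem_divisors]
    exact ⟨by simpa using addOrderOf_dvd_natCard k, NeZero.ne n⟩
  rw [← Finset.sum_fiberwise_of_maps_to hmaps]
  refine Finset.sum_congr rfl fun m hm => ?_
  have hcard : (Finset.univ.filter fun k : ZMod n => addOrderOf k = m).card = m.totient :=
    IsAddCyclic.card_addOrderOf_eq_totient (by
      rw [ZMod.card]
      exact Nat.dvd_of_mem_divisors hm)
  rw [← hcard, ← smul_eq_mul, ← Finset.sum_const]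
  refine Finset.sum_congr rfl fun k hk => ?_
  rw [(Finset.mem_filter.1 hk).2]

/-- A colouring is primitive if no nontrivial rotation fixes it. -/
def CycleColoring.Primitive {n : ℕ} (f : CycleColoring n) : Prop :=
  ∀ k : ZMod n, k +ᵥ f = f → k = 0

theorem CycleColoring.Primitive.vadd {n : ℕ} {f : CycleColoring n} (hf : f.Primitive)
    (l : ZMod n) : CycleColoring.Primitive (l +ᵥ f) := fun k hk => by
  refine hf k (AddAction.injective l ?_)
  change l +ᵥ k +ᵥ f = l +ᵥ f
  rwa [vadd_comm]

theorem period_one_dvd {n : ℕ} (f : CycleColoring n) :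
    AddAction.period (1 : ZMod n) f ∣ n := by
  rw [← AddAction.nsmul_vadd_eq_iff_period_dvd]
  simp

theorem natCast_vadd_eq_iff_period_dvd {n : ℕ} (f : CycleColoring n) (m : ℕ) :
    (m : ZMod n) +ᵥ f = f ↔ AddAction.period (1 : ZMod n) f ∣ m := by
  rw [← AddAction.nsmul_vadd_eq_iff_period_dvd, nsmul_one]

theorem CycleColoring.primitive_iff_period_eq {n : ℕ} [NeZero n] (f : CycleColoring n) :
    f.Primitive ↔ AddAction.period (1 : ZMod n) f = n := by
  constructor
  · intro hf
    refine Nat.dvd_antisymm (period_one_dvd f) ?_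
    rw [← ZMod.natCast_eq_zero_iff]
    exact hf _ ((natCast_vadd_eq_iff_period_dvd f _).2 dvd_rfl)
  · intro hp k hk
    rw [← ZMod.natCast_zmod_val k] at hk ⊢
    rw [natCast_vadd_eq_iff_period_dvd, hp] at hk
    rwa [ZMod.natCast_eq_zero_iff]

theorem sum_divisors_moebius (m : ℕ) :
    ∑ d ∈ m.divisors, ArithmeticFunction.moebius d = if m = 1 then 1 else 0 := by
  rw [← ArithmeticFunction.coe_mul_zeta_apply, ArithmeticFunction.moebius_mul_coe_zeta,
    ArithmeticFunction.one_apply]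

theorem sum_moebius_rotation_fixed {n : ℕ} [NeZero n] (f : CycleColoring n)
    [DecidablePred fun d : ℕ => ((n / d : ℕ) : ZMod n) +ᵥ f = f] [Decidable f.Primitive] :
    ∑ d ∈ n.divisors with ((n / d : ℕ) : ZMod n) +ᵥ f = f, ArithmeticFunction.moebius d =
      if f.Primitive then 1 else 0 := by
  have hn : n ≠ 0 := NeZero.ne n
  obtain ⟨q, hq⟩ := period_one_dvd f
  have hp0 : AddAction.period (1 : ZMod n) f ≠ 0 := fun h => hn (by rw [hq, h, zero_mul])
  have hq0 : q ≠ 0 := fun h => hn (by rw [hq, h, mul_zero])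
  have hset : (n.divisors.filter fun d : ℕ => ((n / d : ℕ) : ZMod n) +ᵥ f = f) = q.divisors := by
    ext d
    rw [Finset.mem_filter, Nat.mem_divisors, Nat.mem_divisors, natCast_vadd_eq_iff_period_dvd]
    constructor
    · rintro ⟨⟨hd, -⟩, hpd⟩
      refine ⟨?_, hq0⟩
      rw [Nat.dvd_div_iff_mul_dvd hd] at hpd
      rw [mul_comm] at hpd
      refine Nat.dvd_of_mul_dvd_mul_left (Nat.pos_of_ne_zero hp0) ?_
      rwa [← hq]
    · rintro ⟨hd, -⟩
      have hdn : d ∣ n := hd.trans ⟨_, hq.trans (mul_comm _ _)⟩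
      refine ⟨⟨hdn, hn⟩, ?_⟩
      rw [Nat.dvd_div_iff_mul_dvd hdn, mul_comm]
      exact (mul_dvd_mul_left _ hd).trans hq.symm.dvd
  rw [hset, sum_divisors_moebius]
  refine if_congr ?_ rfl rfl
  rw [f.primitive_iff_period_eq]
  constructor
  · rintro rfl
    rw [mul_one] at hq
    exact hq.symm
  · intro h
    rw [h] at hq
    exact (Nat.eq_of_mul_eq_mul_left (Nat.pos_of_ne_zero hn) (by rw [mul_one]; exact hq)).symm

theorem card_primitive_colorings {n : ℕ} [NeZero n] :
    (Nat.card {f : CycleColoring n // f.Primitive} : ℤ) =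
      ∑ m ∈ n.divisors, ArithmeticFunction.moebius m * 3 ^ (n / m) := by
  classical
  have hn : n ≠ 0 := NeZero.ne n
  have hcount (m : ℕ) (hm : m ∈ n.divisors) :
      ((3 : ℤ) ^ (n / m)) =
        ∑ f : CycleColoring n, if ((n / m : ℕ) : ZMod n) +ᵥ f = f then 1 else 0 := by
    have hmn := Nat.dvd_of_mem_divisors hm
    have hord : addOrderOf ((n / m : ℕ) : ZMod n) = m := by
      rw [ZMod.addOrderOf_coe _ hn, Nat.gcd_eq_right (Nat.div_dvd_of_dvd hmn),
        Nat.div_div_self hmn hn]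
    have h := card_rotation_fixedBy ((n / m : ℕ) : ZMod n)
    rw [hord, Nat.card_eq_fintype_card, Fintype.card_subtype] at h
    rw [Finset.sum_boole]
    exact_mod_cast h.symm
  rw [Finset.sum_congr rfl fun m hm => by rw [hcount m hm, Finset.mul_sum], Finset.sum_comm,
    Nat.card_eq_fintype_card, Fintype.card_subtype, ← Finset.sum_boole]
  refine Finset.sum_congr rfl fun f _ => ?_
  rw [← sum_moebius_rotation_fixed f, Finset.sum_filter]
  exact Finset.sum_congr rfl fun m _ => by rw [mul_ite, mul_one, mul_zero]

theorem mul_card_primitive_orbits {n : ℕ} [NeZero n] :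
    n * Nat.card {o : AddAction.orbitRel.Quotient (ZMod n) (CycleColoring n) //
        ∀ f : CycleColoring n, Quotient.mk _ f = o → f.Primitive} =
      Nat.card {f : CycleColoring n // f.Primitive} := by
  classical
  let π (f : CycleColoring n) : AddAction.orbitRel.Quotient (ZMod n) (CycleColoring n) :=
    Quotient.mk _ f
  have hrel (f h : CycleColoring n) : π f = π h ↔ ∃ k : ZMod n, k +ᵥ h = f :=
    Quotient.eq.trans (AddAction.orbitRel_apply.trans AddAction.mem_orbit_iff)
  rw [Nat.card_eq_fintype_card, Nat.card_eq_fintype_card, Fintype.card_subtype,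
    Fintype.card_subtype]
  have hmaps : Set.MapsTo π ((Finset.univ.filter fun f : CycleColoring n => f.Primitive) :
      Finset (CycleColoring n)) ((Finset.univ.filter fun o => ∀ f, π f = o → f.Primitive) :
      Finset (AddAction.orbitRel.Quotient (ZMod n) (CycleColoring n))) := by
    intro f hf
    simp only [Finset.coe_filter, Finset.mem_univ, true_and, Set.mem_ofPred_eq] at hf ⊢
    intro h hh
    obtain ⟨k, rfl⟩ := (hrel h f).1 hh
    exact hf.vadd k
  rw [Finset.card_eq_sum_card_fiberwise hmaps, mul_comm, ← smul_eq_mul, ← Finset.sum_const]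
  refine Finset.sum_congr rfl fun o ho => ?_
  obtain ⟨f, rfl⟩ := Quotient.exists_rep o
  have hprim : ∀ h, π h = π f → h.Primitive := (Finset.mem_filter.1 ho).2
  have hinj : Function.Injective fun k : ZMod n => k +ᵥ f := by
    intro k l hkl
    have hkl' : k +ᵥ f = l +ᵥ f := hkl
    refine sub_eq_zero.1 (hprim f rfl _ ?_)
    rw [sub_eq_neg_add, add_vadd, hkl', neg_vadd_vadd]
  have himage : (Finset.univ.filter fun h : CycleColoring n => h.Primitive).filter
      (fun h => π h = π f) = Finset.univ.image fun k : ZMod n => k +ᵥ f := by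
    ext h
    simp only [Finset.mem_filter, Finset.mem_univ, true_and, Finset.mem_image, ← hrel]
    exact ⟨fun hh => hh.2, fun hh => ⟨hprim h hh, hh⟩⟩
  have hcard := congrArg Finset.card himage
  rw [Finset.card_image_of_injective _ hinj, Finset.card_univ, ZMod.card] at hcard
  exact hcard.symm

/-- The zeros of the bistable nonlinearity. -/
def bistableRoot (a : ℝ) : Fin 3 → ℝ := ![0, a, 1]

/-- The derivatives of the bistable nonlinearity at its zeros. -/
def bistableSlope (a : ℝ) : Fin 3 → ℝ := ![-a, a * (1 - a), a - 1]

/-- The radius of the neighbourhoods of the zeros in which stationary solutions are located. -/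
noncomputable def rootRadius (a : ℝ) : ℝ := a * (1 - a) / 52

section Nonlinearity

variable {a : ℝ}

theorem g_bistableRoot (a : ℝ) (k : Fin 3) : g a (bistableRoot a k) = 0 := by
  fin_cases k <;> simp [g, bistableRoot]

theorem bistableRoot_mem (ha : a ∈ Set.Ioo (0 : ℝ) 1) (k : Fin 3) :
    bistableRoot a k ∈ Set.Icc (0 : ℝ) 1 := by
  obtain ⟨h0, h1⟩ := ha
  fin_cases k <;> simp [bistableRoot, h0.le, h1.le]

theorem le_abs_bistableSlope (ha : a ∈ Set.Ioo (0 : ℝ) 1) (k : Fin 3) :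
    a * (1 - a) ≤ |bistableSlope a k| := by
  obtain ⟨h0, h1⟩ := ha
  fin_cases k
  · simp only [bistableSlope, Fin.zero_eta, Matrix.cons_val_zero, abs_neg, abs_of_pos h0]
    nlinarith
  · exact le_abs_self _
  · simp only [bistableSlope, Fin.reduceFinMk, Matrix.cons_val]
    rw [abs_of_neg (by linarith)]
    nlinarith

theorem rootRadius_pos (ha : a ∈ Set.Ioo (0 : ℝ) 1) : 0 < rootRadius a := by
  have := mul_pos ha.1 (sub_pos.2 ha.2)
  unfold rootRadius
  positivity

theorem rootRadius_lt_one (ha : a ∈ Set.Ioo (0 : ℝ) 1) : rootRadius a < 1 := by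
  obtain ⟨h0, h1⟩ := ha
  unfold rootRadius
  nlinarith

theorem bistableSlope_eq (a : ℝ) (k : Fin 3) :
    bistableSlope a k = -3 * bistableRoot a k ^ 2 + 2 * (1 + a) * bistableRoot a k - a := by
  fin_cases k <;> simp [bistableSlope, bistableRoot] <;> ring

/-- Near a zero the nonlinearity is close to its linearization. -/
theorem abs_linearization_error_le (ha : a ∈ Set.Ioo (0 : ℝ) 1) {k : Fin 3} {x y : ℝ}
    (hx : |x - bistableRoot a k| ≤ rootRadius a) (hy : |y - bistableRoot a k| ≤ rootRadius a) :
    |(x - y) * bistableSlope a k - (g a x - g a y)| ≤ a * (1 - a) / 4 * |x - y| := by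
  have hr := bistableRoot_mem ha k
  have hδ := rootRadius_lt_one ha
  have hδ' := rootRadius_pos ha
  have hδc : a * (1 - a) / 4 = 13 * rootRadius a := by unfold rootRadius; ring
  rw [bistableSlope_eq, hδc]
  generalize bistableRoot a k = r at *
  generalize rootRadius a = δ at *
  obtain ⟨h0, h1⟩ := ha
  obtain ⟨s, rfl⟩ : ∃ s, x = r + s := ⟨x - r, by ring⟩
  obtain ⟨t, rfl⟩ : ∃ t, y = r + t := ⟨y - r, by ring⟩
  rw [add_sub_cancel_left] at hx hy
  have hfac : (r + s - (r + t)) * (-3 * r ^ 2 + 2 * (1 + a) * r - a) - (g a (r + s) - g a (r + t))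
      = ((s + t) * (3 * r - 1 - a) + (s * s + s * t + t * t)) * (r + s - (r + t)) := by
    unfold g; ring
  rw [hfac, abs_mul]
  refine mul_le_mul_of_nonneg_right ?_ (abs_nonneg _)
  have hst : |s + t| ≤ 2 * δ := (abs_add_le _ _).trans (by linarith)
  have hcoef : |3 * r - 1 - a| ≤ 3 := abs_le.2 ⟨by linarith [hr.1], by linarith [hr.2]⟩
  have hprod {p q : ℝ} (hp : |p| ≤ δ) (hq : |q| ≤ δ) : |p * q| ≤ δ := by
    rw [abs_mul]
    nlinarith [abs_nonneg p, abs_nonneg q]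
  have hlin : |(s + t) * (3 * r - 1 - a)| ≤ 6 * δ := by
    rw [abs_mul]
    nlinarith [abs_nonneg (s + t), abs_nonneg (3 * r - 1 - a)]
  have hquad : |s * s + s * t + t * t| ≤ 3 * δ :=
    (abs_add_three _ _ _).trans (by linarith [hprod hx hx, hprod hx hy, hprod hy hy])
  exact (abs_add_le _ _).trans (by linarith)

/-- The neighbourhoods of distinct zeros are disjoint. -/
theorem bistableRoot_index_unique (ha : a ∈ Set.Ioo (0 : ℝ) 1) {k l : Fin 3} {x : ℝ}
    (hk : |x - bistableRoot a k| ≤ rootRadius a) (hl : |x - bistableRoot a l| ≤ rootRadius a) :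
    k = l := by
  obtain ⟨h0, h1⟩ := ha
  have hc0 : a * (1 - a) < a := by nlinarith
  have hc1 : a * (1 - a) < 1 - a := by nlinarith
  have hc : 0 < a * (1 - a) := by nlinarith
  unfold rootRadius at hk hl
  rw [abs_le] at hk hl
  fin_cases k <;> fin_cases l <;> first
    | rfl
    | (exfalso; simp [bistableRoot] at hk hl; linarith)

/-- A point where the nonlinearity is small lies near one of its zeros. -/
theorem exists_near_bistableRoot (ha : a ∈ Set.Ioo (0 : ℝ) 1) {x : ℝ}
    (hx : |g a x| ≤ rootRadius a ^ 3) : ∃ k, |x - bistableRoot a k| ≤ rootRadius a := by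
  by_contra! hfar
  have hδ := rootRadius_pos ha
  have hx0 := hfar 0
  have hxa := hfar 1
  have hx1 := hfar 2
  simp only [bistableRoot, Matrix.cons_val, sub_zero] at hx0 hxa hx1
  refine hx.not_gt ?_
  unfold g
  rw [abs_mul, abs_mul, abs_sub_comm 1 x, pow_three']
  gcongr

end Nonlinearity

/-- The equation for stationary solutions on the discrete cycle `ZMod n`. -/
def CycleStationary (n : ℕ) (a d : ℝ) (w : ZMod n → ℝ) : Prop :=
  ∀ i, d * (w (i - 1) - 2 * w i + w (i + 1)) + g a (w i) = 0

theorem exists_lift_of_periodic {n : ℕ} [NeZero n] {u : ℤ → ℝ} (hu : ∀ i : ℤ, u (i + n) = u i) :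
    ∃ w : ZMod n → ℝ, ∀ k : ℤ, u k = w k := by
  refine ⟨fun i => u i.val, fun k => ?_⟩
  have hper : Function.Periodic u (n : ℤ) := hu
  have h := hper.sub_zsmul_eq (x := k) (k / n)
  rw [← h]
  refine congrArg u ?_
  rw [ZMod.val_intCast, Int.emod_def, smul_eq_mul, mul_comm]

theorem cycleStationary_iff {n : ℕ} [NeZero n] {a d : ℝ} {u : ℤ → ℝ} {w : ZMod n → ℝ}
    (huw : ∀ k : ℤ, u k = w k) : u ∈ PerStat n a d ↔ CycleStationary n a d w := by
  constructor
  · rintro ⟨-, hu⟩ i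
    obtain ⟨k, rfl⟩ := ZMod.intCast_surjective i
    have h := hu k
    simp only [huw] at h
    push_cast at h
    exact h
  · intro hw
    refine ⟨fun i => by simp [huw], fun i => ?_⟩
    simp only [huw]
    push_cast
    exact hw i

theorem CycleStationary.mem_Icc {n : ℕ} [NeZero n] {a d : ℝ} (ha : a ∈ Set.Ioo (0 : ℝ) 1)
    (hd : 0 < d) {w : ZMod n → ℝ} (hw : CycleStationary n a d w) (i : ZMod n) :
    w i ∈ Set.Icc (0 : ℝ) 1 := by
  obtain ⟨h0, h1⟩ := ha
  obtain ⟨j, hj⟩ := Finite.exists_min w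
  obtain ⟨l, hl⟩ := Finite.exists_max w
  refine ⟨le_trans ?_ (hj i), (hl i).trans ?_⟩
  · by_contra! hneg
    have hg : 0 < g a (w j) := by
      have : 0 < -w j * (1 - w j) * (a - w j) :=
        mul_pos (mul_pos (by linarith) (by linarith)) (by linarith)
      unfold g
      linarith
    have hlap : 0 ≤ d * (w (j - 1) - 2 * w j + w (j + 1)) :=
      mul_nonneg hd.le (by linarith [hj (j - 1), hj (j + 1)])
    linarith [hw j]
  · by_contra! hgt
    have hg : g a (w l) < 0 := by
      have : 0 < w l * (w l - 1) * (w l - a) :=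
        mul_pos (mul_pos (by linarith) (by linarith)) (by linarith)
      unfold g
      linarith
    have hlap : 0 ≤ d * (-(w (l - 1) - 2 * w l + w (l + 1))) :=
      mul_nonneg hd.le (by linarith [hl (l - 1), hl (l + 1)])
    linarith [hw l]

theorem CycleStationary.exists_near_bistableRoot {n : ℕ} [NeZero n] {a d : ℝ}
    (ha : a ∈ Set.Ioo (0 : ℝ) 1) (hd : 0 < d) (hdr : 2 * d ≤ rootRadius a ^ 3)
    {w : ZMod n → ℝ} (hw : CycleStationary n a d w) (i : ZMod n) :
    ∃ k, |w i - bistableRoot a k| ≤ rootRadius a := by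
  refine _root_.exists_near_bistableRoot ha (le_trans ?_ hdr)
  have hm := hw.mem_Icc ha hd
  have hlap : |w (i - 1) - 2 * w i + w (i + 1)| ≤ 2 :=
    abs_le.2 ⟨by linarith [(hm (i - 1)).1, (hm i).2, (hm (i + 1)).1],
      by linarith [(hm (i - 1)).2, (hm i).1, (hm (i + 1)).2]⟩
  rw [eq_neg_of_add_eq_zero_right (hw i), abs_neg, abs_mul, abs_of_pos hd]
  nlinarith

/-- The simplified Newton map whose fixed points near `bistableRoot a ∘ s` are the stationary
solutions with symbolic code `s`. -/
noncomputable def newtonMap {n : ℕ} (a d : ℝ) (s : CycleColoring n) (w : ZMod n → ℝ) :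
    ZMod n → ℝ :=
  fun i => w i - (d * (w (i - 1) - 2 * w i + w (i + 1)) + g a (w i)) / bistableSlope a (s i)

/-- The states that follow the zeros prescribed by the code `s`. -/
def codeBox {n : ℕ} (a : ℝ) (s : CycleColoring n) : Set (ZMod n → ℝ) :=
  {w | ∀ i, |w i - bistableRoot a (s i)| ≤ rootRadius a}

section Newton

variable {n : ℕ} {a d : ℝ} {s : CycleColoring n}

theorem bistableSlope_ne_zero (ha : a ∈ Set.Ioo (0 : ℝ) 1) (k : Fin 3) :
    bistableSlope a k ≠ 0 :=
  abs_pos.1 ((mul_pos ha.1 (sub_pos.2 ha.2)).trans_le (le_abs_bistableSlope ha k))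

theorem isFixedPt_newtonMap_iff (ha : a ∈ Set.Ioo (0 : ℝ) 1) {w : ZMod n → ℝ} :
    Function.IsFixedPt (newtonMap a d s) w ↔ CycleStationary n a d w := by
  simp only [Function.IsFixedPt, newtonMap, funext_iff, CycleStationary, sub_eq_self,
    div_eq_zero_iff, bistableSlope_ne_zero ha, or_false]

theorem abs_newton_quotient_le (ha : a ∈ Set.Ioo (0 : ℝ) 1) (k : Fin 3) {p C : ℝ}
    (hC : 0 ≤ C) (hp : |p| ≤ a * (1 - a) * C) : |p / bistableSlope a k| ≤ C := by
  rw [abs_div, div_le_iff₀ (abs_pos.2 (bistableSlope_ne_zero ha k)), mul_comm]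
  exact hp.trans (mul_le_mul_of_nonneg_right (le_abs_bistableSlope ha k) hC)

theorem mapsTo_newtonMap (ha : a ∈ Set.Ioo (0 : ℝ) 1) (hd : 0 < d)
    (hdr : 2 * d ≤ rootRadius a ^ 3) :
    Set.MapsTo (newtonMap a d s) (codeBox a s) (codeBox a s) := by
  intro w hw i
  have hδ := rootRadius_pos ha
  have hδ1 := rootRadius_lt_one ha
  have hm := bistableSlope_ne_zero ha (s i)
  have hroot : newtonMap a d s w i - bistableRoot a (s i) =
      ((w i - bistableRoot a (s i)) * bistableSlope a (s i) -
        (g a (w i) - g a (bistableRoot a (s i))) -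
        d * (w (i - 1) - 2 * w i + w (i + 1))) / bistableSlope a (s i) := by
    rw [g_bistableRoot, newtonMap]
    field_simp
    ring
  rw [hroot]
  refine abs_newton_quotient_le ha _ hδ.le ((abs_sub _ _).trans ?_)
  have hlin := abs_linearization_error_le ha (hw i)
    (by rw [sub_self, abs_zero]; exact hδ.le : |bistableRoot a (s i) - bistableRoot a (s i)| ≤ _)
  have hbd (j : ZMod n) : -1 ≤ w j ∧ w j ≤ 2 := by
    have h := abs_le.1 (hw j)
    have hr := bistableRoot_mem ha (s j)
    exact ⟨by linarith [h.1, hr.1], by linarith [h.2, hr.2]⟩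
  have hlap : |w (i - 1) - 2 * w i + w (i + 1)| ≤ 6 :=
    abs_le.2 ⟨by linarith [hbd (i - 1), hbd i, hbd (i + 1)],
      by linarith [hbd (i - 1), hbd i, hbd (i + 1)]⟩
  have hcδ : a * (1 - a) = 52 * rootRadius a := by unfold rootRadius; ring
  rw [hcδ] at hlin ⊢
  rw [abs_mul, abs_of_pos hd]
  have hwi := hw i
  generalize rootRadius a = δ at *
  have hcube : δ ^ 3 ≤ δ * δ := by nlinarith [mul_pos hδ hδ]
  nlinarith [mul_pos hδ hδ]

theorem dist_newtonMap_le [NeZero n] (ha : a ∈ Set.Ioo (0 : ℝ) 1) (hd : 0 < d)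
    (hdr : 2 * d ≤ rootRadius a ^ 3) {v w : ZMod n → ℝ} (hv : v ∈ codeBox a s)
    (hw : w ∈ codeBox a s) :
    dist (newtonMap a d s v) (newtonMap a d s w) ≤ 1 / 2 * dist v w := by
  have hD : 0 ≤ dist v w := dist_nonneg
  refine (dist_pi_le_iff (by positivity)).2 fun i => ?_
  have hδ := rootRadius_pos ha
  have hδ1 := rootRadius_lt_one ha
  have hm := bistableSlope_ne_zero ha (s i)
  have hdiff : newtonMap a d s v i - newtonMap a d s w i =
      ((v i - w i) * bistableSlope a (s i) - (g a (v i) - g a (w i)) -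
        d * ((v (i - 1) - w (i - 1)) - 2 * (v i - w i) + (v (i + 1) - w (i + 1)))) /
        bistableSlope a (s i) := by
    rw [newtonMap, newtonMap]
    field_simp
    ring
  rw [Real.dist_eq, hdiff]
  refine abs_newton_quotient_le ha _ (by positivity) ((abs_sub _ _).trans ?_)
  have hlin := abs_linearization_error_le ha (hv i) (hw i)
  have hbd (j : ZMod n) : |v j - w j| ≤ dist v w := dist_le_pi_dist v w j
  have hlap : |(v (i - 1) - w (i - 1)) - 2 * (v i - w i) + (v (i + 1) - w (i + 1))| ≤
      4 * dist v w := by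
    have hp := abs_le.1 (hbd (i - 1))
    have hc := abs_le.1 (hbd i)
    have hs := abs_le.1 (hbd (i + 1))
    exact abs_le.2 ⟨by linarith, by linarith⟩
  have hcδ : a * (1 - a) = 52 * rootRadius a := by unfold rootRadius; ring
  rw [hcδ] at hlin ⊢
  rw [abs_mul, abs_of_pos hd]
  have hvi := hbd i
  generalize rootRadius a = δ at *
  generalize dist v w = D at *
  have hcube : δ ^ 3 ≤ δ := by nlinarith [mul_pos hδ hδ]
  have hdδ : d ≤ δ := by linarith
  have h1 := mul_le_mul_of_nonneg_left hlap hd.le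
  have h2 := mul_le_mul_of_nonneg_right hdδ hD
  have h3 := mul_le_mul_of_nonneg_left hvi hδ.le
  nlinarith

theorem existsUnique_cycleStationary_of_code [NeZero n] (ha : a ∈ Set.Ioo (0 : ℝ) 1) (hd : 0 < d)
    (hdr : 2 * d ≤ rootRadius a ^ 3) (s : CycleColoring n) :
    ∃! w, CycleStationary n a d w ∧ w ∈ codeBox a s := by
  have hcontr {v w : ZMod n → ℝ} (hv : v ∈ codeBox a s) (hw : w ∈ codeBox a s) :=
    dist_newtonMap_le ha hd hdr hv hw
  have hclosed : IsClosed (codeBox a s) := by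
    simp only [codeBox, Set.ofPred_forall]
    exact isClosed_iInter fun i => isClosed_le (by fun_prop) continuous_const
  have hmaps := mapsTo_newtonMap (s := s) ha hd hdr
  have hK : ContractingWith (1 / 2) (hmaps.restrict (newtonMap a d s) _ _) := by
    refine ⟨by norm_num [← NNReal.coe_lt_coe], LipschitzWith.of_dist_le_mul fun v w => ?_⟩
    simpa [Subtype.dist_eq] using hcontr v.2 w.2
  have hcenter : (fun i => bistableRoot a (s i)) ∈ codeBox a s := fun i => by
    simpa using (rootRadius_pos ha).le
  obtain ⟨w, hwbox, hwfix, -⟩ :=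
    hK.exists_fixedPoint' hclosed.isComplete hmaps hcenter (edist_ne_top _ _)
  refine ⟨w, ⟨(isFixedPt_newtonMap_iff ha).1 hwfix, hwbox⟩, ?_⟩
  rintro v ⟨hvstat, hvbox⟩
  have h := hcontr hvbox hwbox
  rw [hwfix.eq, ((isFixedPt_newtonMap_iff (s := s) ha).2 hvstat).eq] at h
  exact dist_le_zero.1 (by linarith)

end Newton

/-- For weak coupling, periodic stationary solutions are coded by colourings of the cycle, and the
unit translation becomes the unit rotation. -/
theorem exists_equiv_cycleColoring {n : ℕ} [NeZero n] {a d : ℝ} (ha : a ∈ Set.Ioo (0 : ℝ) 1)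
    (hd : 0 < d) (hdr : 2 * d ≤ rootRadius a ^ 3) :
    ∃ Φ : PerStat n a d ≃ CycleColoring n,
      ∀ u v, TransRel n a d u v → Φ v = (1 : ZMod n) +ᵥ Φ u := by
  let Coded (u : PerStat n a d) (s : CycleColoring n) : Prop :=
    ∀ k : ℤ, |u.1 k - bistableRoot a (s k)| ≤ rootRadius a
  have hcode_unique {u : PerStat n a d} {s t : CycleColoring n} (hs : Coded u s)
      (ht : Coded u t) : s = t := by
    funext i
    obtain ⟨k, rfl⟩ := ZMod.intCast_surjective i
    exact bistableRoot_index_unique ha (hs k) (ht k)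
  have hcode_exists (u : PerStat n a d) : ∃ s, Coded u s := by
    obtain ⟨w, huw⟩ := exists_lift_of_periodic u.2.1
    choose s hs using ((cycleStationary_iff huw).1 u.2).exists_near_bistableRoot ha hd hdr
    exact ⟨s, fun k => by rw [huw]; exact hs k⟩
  choose code hcode using hcode_exists
  have hbij : Function.Bijective code := by
    constructor
    · intro u v huv
      obtain ⟨w, huw⟩ := exists_lift_of_periodic u.2.1
      obtain ⟨z, hvz⟩ := exists_lift_of_periodic v.2.1
      have hbox {u : PerStat n a d} {w : ZMod n → ℝ} (huw : ∀ k : ℤ, u.1 k = w k) :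
          w ∈ codeBox a (code u) := fun i => by
        obtain ⟨k, rfl⟩ := ZMod.intCast_surjective i
        rw [← huw]
        exact hcode u k
      have hwz : w = z := (existsUnique_cycleStationary_of_code ha hd hdr (code u)).unique
        ⟨(cycleStationary_iff huw).1 u.2, hbox huw⟩
        ⟨(cycleStationary_iff hvz).1 v.2, huv ▸ hbox hvz⟩
      exact Subtype.ext (funext fun k => by rw [huw, hvz, hwz])
    · intro s
      obtain ⟨w, ⟨hw, hbox⟩, -⟩ := existsUnique_cycleStationary_of_code ha hd hdr s
      let u : PerStat n a d := ⟨fun k => w k, (cycleStationary_iff fun _ => rfl).2 hw⟩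
      exact ⟨u, hcode_unique (hcode u) fun k => hbox k⟩
  refine ⟨Equiv.ofBijective code hbij, fun u v huv => hcode_unique (hcode v) fun k => ?_⟩
  have h := hcode u (k + 1)
  rw [← huv k] at h
  rw [Equiv.ofBijective_apply, rotation_vadd_apply]
  push_cast at h
  exact h

theorem translate_mem_perStat {n : ℕ} {a d : ℝ} {u : ℤ → ℝ} (hu : u ∈ PerStat n a d) (l : ℤ) :
    (fun i : ℤ => u (i + l)) ∈ PerStat n a d := by
  refine ⟨fun i => ?_, fun i => ?_⟩
  · have h := hu.1 (i + l)
    rwa [add_right_comm] at h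
  · have h := hu.2 (i + l)
    rwa [add_sub_right_comm, add_right_comm] at h

/-- Translation of a periodic stationary solution. -/
def PerStat.translate {n : ℕ} {a d : ℝ} (u : PerStat n a d) (l : ℤ) : PerStat n a d :=
  ⟨fun i => u.1 (i + l), translate_mem_perStat u.2 l⟩

section Coding

variable {n : ℕ} {a d : ℝ}

theorem transRel_translate_succ (u : PerStat n a d) (m : ℕ) :
    TransRel n a d (PerStat.translate u m) (PerStat.translate u (m + 1 : ℕ)) := fun i => by
  refine congrArg u.1 ?_
  push_cast
  ring

theorem quot_mk_translate (u : PerStat n a d) (m : ℕ) :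
    Quot.mk (TransRel n a d) (PerStat.translate u m) = Quot.mk (TransRel n a d) u := by
  induction m with
  | zero =>
    congr 1
    exact Subtype.ext (funext fun i => by simp [PerStat.translate])
  | succ m ih => rw [← ih, ← Quot.sound (transRel_translate_succ u m)]

variable {Φ : PerStat n a d ≃ CycleColoring n}

theorem code_translate (hΦ : ∀ u v, TransRel n a d u v → Φ v = (1 : ZMod n) +ᵥ Φ u)
    (u : PerStat n a d) (m : ℕ) : Φ (PerStat.translate u m) = (m : ZMod n) +ᵥ Φ u := by
  induction m with
  | zero =>
    rw [Nat.cast_zero (R := ZMod n), zero_vadd]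
    congr 1
    exact Subtype.ext (funext fun i => by simp [PerStat.translate])
  | succ m ih =>
    rw [hΦ _ _ (transRel_translate_succ u m), ih, vadd_vadd, Nat.cast_succ, add_comm]

theorem periodic_iff_code_fixed (hΦ : ∀ u v, TransRel n a d u v → Φ v = (1 : ZMod n) +ᵥ Φ u)
    (u : PerStat n a d) (m : ℕ) :
    (∀ i : ℤ, u.1 (i + m) = u.1 i) ↔ (m : ZMod n) +ᵥ Φ u = Φ u := by
  rw [← code_translate hΦ, Φ.apply_eq_iff_eq, Subtype.ext_iff, funext_iff]
  rfl

theorem minPeriodExact_iff_primitive [NeZero n]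
    (hΦ : ∀ u v, TransRel n a d u v → Φ v = (1 : ZMod n) +ᵥ Φ u) (u : PerStat n a d) :
    MinPeriodExact n u.1 ↔ (Φ u).Primitive := by
  constructor
  · rintro ⟨-, hmin⟩ k hk
    by_contra hk0
    rw [← ZMod.natCast_zmod_val k, ← periodic_iff_code_fixed hΦ] at hk
    have hpos : 0 < k.val := Nat.pos_of_ne_zero fun h => hk0 ((ZMod.val_eq_zero k).1 h)
    exact (hmin _ hpos hk).not_gt (ZMod.val_lt k)
  · intro hprim
    refine ⟨u.2.1, fun m hm hper => Nat.le_of_dvd hm ?_⟩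
    rw [← ZMod.natCast_eq_zero_iff]
    exact hprim _ ((periodic_iff_code_fixed hΦ u m).1 hper)

/-- The coding identifies translation classes of solutions with rotation classes of colourings. -/
theorem exists_orbit_equiv [NeZero n]
    (hΦ : ∀ u v, TransRel n a d u v → Φ v = (1 : ZMod n) +ᵥ Φ u) :
    ∃ e : Quot (TransRel n a d) ≃ AddAction.orbitRel.Quotient (ZMod n) (CycleColoring n),
      ∀ u, e (Quot.mk _ u) = Quotient.mk _ (Φ u) := by
  let F : Quot (TransRel n a d) → AddAction.orbitRel.Quotient (ZMod n) (CycleColoring n) :=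
    Quot.lift (fun u => Quotient.mk _ (Φ u)) fun u v huv =>
      (Quotient.sound (AddAction.orbitRel_apply.2 ⟨1, (hΦ u v huv).symm⟩)).symm
  refine ⟨Equiv.ofBijective F ⟨?_, ?_⟩, fun _ => rfl⟩
  · rintro ⟨u⟩ ⟨v⟩ huv
    obtain ⟨k, hk⟩ := AddAction.orbitRel_apply.1 (Quotient.exact huv)
    have hk' : (k.val : ZMod n) +ᵥ Φ v = Φ u := by rw [ZMod.natCast_zmod_val]; exact hk
    rw [← code_translate hΦ, Φ.apply_eq_iff_eq] at hk'
    rw [← hk']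
    exact quot_mk_translate v _
  · intro o
    obtain ⟨f, rfl⟩ := Quotient.exists_rep o
    exact ⟨Quot.mk _ (Φ.symm f), by simp [F]⟩

end Coding

/-- For `n ≥ 3`, `a ∈ (0,1)` and all small `d > 0`: the lattice Nagumo equation has
exactly `3ⁿ` `n`-periodic stationary solutions, the set of these solutions is invariant
under translations, the number of translation orbits is `N₃(n) = (1/n)∑_{d'∣n} φ(d')3^{n/d'}`,
and exactly `L₃(n) = (1/n)∑_{d'∣n} μ(d')3^{n/d'}` of these orbits consist of solutions
of minimal period exactly `n`. -/
theorem periodic_solution_necklace_count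
    (n : ℕ) (hn : 3 ≤ n) (a : ℝ) (ha : a ∈ Set.Ioo (0:ℝ) 1) :
    ∃ d0 > (0:ℝ), ∀ d ∈ Set.Ioo (0:ℝ) d0,
      (PerStat n a d).ncard = 3 ^ n ∧
      (∀ u ∈ PerStat n a d, ∀ ℓ : ℤ, (fun i : ℤ => u (i + ℓ)) ∈ PerStat n a d) ∧
      n * Nat.card (Quot (TransRel n a d)) =
        ∑ d' ∈ n.divisors, Nat.totient d' * 3 ^ (n / d') ∧
      ((n : ℤ) * ({o : Quot (TransRel n a d) |
          ∀ u : PerStat n a d, Quot.mk (TransRel n a d) u = o →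
            MinPeriodExact n (u : ℤ → ℝ)}.ncard : ℤ) =
        ∑ d' ∈ n.divisors, ArithmeticFunction.moebius d' * 3 ^ (n / d')) := by
  have : NeZero n := ⟨by lia⟩
  refine ⟨rootRadius a ^ 3 / 2, half_pos (pow_pos (rootRadius_pos ha) 3), ?_⟩
  rintro d ⟨hd, hdr⟩
  obtain ⟨Φ, hΦ⟩ := exists_equiv_cycleColoring (n := n) ha hd (by linarith)
  obtain ⟨e, he⟩ := exists_orbit_equiv hΦ
  refine ⟨?_, fun u hu l => translate_mem_perStat hu l, ?_, ?_⟩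
  · rw [← Nat.card_coe_set_eq, Nat.card_congr Φ, Nat.card_fun, Nat.card_zmod, Nat.card_fin]
  · rw [Nat.card_congr e, mul_card_rotation_orbits]
  · rw [← card_primitive_colorings, ← mul_card_primitive_orbits, Nat.cast_mul,
      ← Nat.card_coe_set_eq]
    congr 2
    refine Nat.card_congr (e.subtypeEquiv fun o => ?_)
    constructor
    · intro ho f hf
      obtain ⟨u, rfl⟩ := Φ.surjective f
      rw [← he, e.apply_eq_iff_eq] at hf
      exact (minPeriodExact_iff_primitive hΦ u).1 (ho u hf)
    · rintro ho u rfl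
      exact (minPeriodExact_iff_primitive hΦ u).2 (ho _ (he u).symm)
end

section
/- Fix $n \ge 3$ and $a \in (0,1)$. There exists $d_0 > 0$ such that for every $d \in (0, d_0)$: the set $S$ of $n$-periodic stationary solutions of the lattice Nagumo equation has exactly $3^n$ elements, the dihedral group of order $2n$ acts on $S$ by translations $(\mathcal{T}_\ell u)_i = u_{i+\ell}$ and reflection $(\mathcal{R} u)_i = u_{1-i}$, the number of orbits of this action equals $B_3(n)$, and exactly $BL_3(n) = \sum_{d' \mid n}\mu(d')B_3(n/d')$ of these orbits consist of solutions whose minimal period is exactly $n$. -/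
/-- The generating relation of the dihedral action on `n`-periodic stationary
solutions: `v` is either the translate `(T₁ u)_i = u_{i+1}` or the reflection
`(R u)_i = u_{1-i}` of `u`. The quotient `Quot (DihSeqRel n a d)` identifies
solutions in the same orbit of the dihedral group of order `2n`. -/
def DihSeqRel (n : ℕ) (a d : ℝ) (u v : PerStat n a d) : Prop :=
  (∀ i : ℤ, (v : ℤ → ℝ) i = (u : ℤ → ℝ) (i + 1)) ∨
  (∀ i : ℤ, (v : ℤ → ℝ) i = (u : ℤ → ℝ) (1 - i))

/-- `N_k(n) = (1/n) ∑_{d'∣n} φ(d') k^{n/d'}`, the necklace-counting function. -/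
def Nq (k n : ℕ) : ℚ :=
  (1 / n) * ∑ d ∈ n.divisors, (Nat.totient d : ℚ) * (k : ℚ) ^ (n / d)

/-- `B_k(n)`, the bracelet-counting function. -/
def Bq (k n : ℕ) : ℚ :=
  if Even n then (1 / 2) * (Nq k n + ((k : ℚ) + 1) / 2 * (k : ℚ) ^ (n / 2))
  else (1 / 2) * (Nq k n + (k : ℚ) ^ ((n + 1) / 2))

/-- `BL_k(n) = ∑_{d'∣n} μ(d') B_k(n/d')`, the Lyndon-bracelet-counting function. -/
def BLq (k n : ℕ) : ℚ :=
  ∑ d ∈ n.divisors, (ArithmeticFunction.moebius d : ℚ) * Bq k (n / d)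

namespace Nagumo

/-- The three roots `0, a, 1` of the nonlinearity. -/
noncomputable def root (a : ℝ) : Fin 3 → ℝ := ![0, a, 1]

/-- The derivatives of the nonlinearity at its three roots. -/
noncomputable def slope (a : ℝ) : Fin 3 → ℝ := ![-a, a * (1 - a), -(1 - a)]

/-- Colour of a real number: the index of the root it is `δ`-close to. -/
noncomputable def color (a δ x : ℝ) : Fin 3 :=
  if |x| ≤ δ then 0 else if |x - a| ≤ δ then 1 else 2

/-- The colouring radius used for parameter `a`. -/
noncomputable def radius (a : ℝ) : ℝ := a * (1 - a) / 16

section Local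

variable {a : ℝ}

lemma radius_pos (ha : a ∈ Set.Ioo (0 : ℝ) 1) : 0 < radius a := by
  have := mul_pos ha.1 (sub_pos.2 ha.2)
  unfold radius
  linarith

lemma radius_le (a : ℝ) : radius a ≤ 1 / 64 := by
  unfold radius
  nlinarith [sq_nonneg (a - 1 / 2)]

lemma le_abs_slope (ha : a ∈ Set.Ioo (0 : ℝ) 1) (k : Fin 3) :
    16 * radius a ≤ |slope a k| := by
  obtain ⟨h0, h1⟩ := ha
  unfold radius
  fin_cases k
  · simp [slope, abs_of_pos h0]; nlinarith
  · simp [slope]; rw [mul_div_cancel₀ _ (by norm_num)]; rw [← abs_mul]; exact le_abs_self _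
  · simp only [slope, Fin.reduceFinMk, Matrix.cons_val, abs_neg]
    rw [abs_of_pos (by linarith)]; nlinarith

lemma root_mem_Icc (ha : a ∈ Set.Ioo (0 : ℝ) 1) (k : Fin 3) : root a k ∈ Set.Icc (0 : ℝ) 1 := by
  obtain ⟨h0, h1⟩ := ha
  fin_cases k <;> simp [root, h0.le, h1.le]

lemma g_root (a : ℝ) (k : Fin 3) : g a (root a k) = 0 := by
  fin_cases k <;> simp [root, g]

lemma color_eq_of_abs_sub_root_le (ha : a ∈ Set.Ioo (0 : ℝ) 1) {x : ℝ} {k : Fin 3}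
    (h : |x - root a k| ≤ radius a) : color a (radius a) x = k := by
  have hr : radius a < a / 2 ∧ radius a < (1 - a) / 2 := by
    obtain ⟨h0, h1⟩ := ha
    unfold radius
    constructor <;> nlinarith
  have h1 := ha.1
  have h2 := ha.2
  rw [abs_le] at h
  unfold color
  fin_cases k <;> simp only [root, Fin.zero_eta, Fin.mk_one, Fin.reduceFinMk, Matrix.cons_val] at h
  · rw [if_pos (abs_le.2 (by constructor <;> linarith))]; rfl
  · rw [if_neg (fun h' => by rw [abs_le] at h'; linarith),
      if_pos (abs_le.2 (by constructor <;> linarith))]; rfl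
  · rw [if_neg (fun h' => by rw [abs_le] at h'; linarith),
      if_neg (fun h' => by rw [abs_le] at h'; linarith)]; rfl

lemma abs_sub_root_color_le (ha : a ∈ Set.Ioo (0 : ℝ) 1) {x : ℝ}
    (h : |g a x| < radius a ^ 3) : |x - root a (color a (radius a) x)| ≤ radius a := by
  have hr := radius_pos ha
  suffices ∃ k, |x - root a k| ≤ radius a by
    obtain ⟨k, hk⟩ := this
    rwa [color_eq_of_abs_sub_root_le ha hk]
  by_contra! hc
  have h0 : radius a < |x| := by simpa [root] using hc 0
  have h1 : radius a < |x - a| := by simpa [root] using hc 1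
  have h2 : radius a < |1 - x| := by simpa [root, abs_sub_comm] using hc 2
  apply h.not_ge
  rw [g, abs_mul, abs_mul]
  calc radius a ^ 3 = radius a * radius a * radius a := by ring
    _ ≤ _ := by gcongr

lemma abs_g_sub_g_sub_le (ha : a ∈ Set.Ioo (0 : ℝ) 1) {x y : ℝ} {k : Fin 3}
    (hx : |x - root a k| ≤ radius a) (hy : |y - root a k| ≤ radius a) :
    |g a x - g a y - slope a k * (x - y)| ≤ 8 * radius a * |x - y| := by
  have hr := radius_pos ha
  have hr' := radius_le a
  obtain ⟨s, rfl⟩ : ∃ s, x = root a k + s := ⟨x - root a k, by ring⟩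
  obtain ⟨t, rfl⟩ : ∃ t, y = root a k + t := ⟨y - root a k, by ring⟩
  rw [add_sub_cancel_left] at hx hy
  have key : g a (root a k + s) - g a (root a k + t)
      - slope a k * (root a k + s - (root a k + t))
      = ((1 + a - 3 * root a k) * (s + t) - (s * s + s * t + t * t)) *
        (root a k + s - (root a k + t)) := by
    fin_cases k <;> simp [root, slope, g] <;> ring
  rw [key, abs_mul]
  gcongr
  have hc : |1 + a - 3 * root a k| ≤ 2 := by
    have h1 := ha.1
    have h2 := ha.2
    rw [abs_le]
    fin_cases k <;> simp [root] <;> constructor <;> linarith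
  have hp : ∀ p q : ℝ, |p| ≤ radius a → |q| ≤ radius a → |p * q| ≤ radius a * (1 / 64) := by
    intro p q hp hq
    rw [abs_mul]
    exact mul_le_mul hp (hq.trans hr') (abs_nonneg _) hr.le
  calc _ ≤ |(1 + a - 3 * root a k) * (s + t)| + |s * s + s * t + t * t| := abs_sub _ _
    _ ≤ 2 * (radius a + radius a) + (radius a * (1 / 64) + radius a * (1 / 64)
          + radius a * (1 / 64)) := by
        gcongr
        · rw [abs_mul]
          gcongr
          exact (abs_add_le _ _).trans (add_le_add hx hy)
        · exact (abs_add_three _ _ _).trans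
            (add_le_add (add_le_add (hp _ _ hx hx) (hp _ _ hx hy)) (hp _ _ hy hy))
    _ ≤ 8 * radius a := by linarith

end Local

lemma exists_forall_le_of_periodic {n : ℕ} (hn : 0 < n) {u : ℤ → ℝ}
    (hu : ∀ i : ℤ, u (i + n) = u i) : ∃ i, ∀ j, u j ≤ u i := by
  have hn' : (0 : ℤ) < n := by exact_mod_cast hn
  obtain ⟨i, -, hi⟩ := Finset.exists_max_image (Finset.Ico (0 : ℤ) n) u
    ⟨0, by simpa using hn⟩
  refine ⟨i, fun j => ?_⟩
  have hp : Function.Periodic u (n : ℤ) := hu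
  have hj : u (j % n) = u j := by
    have := hp.sub_zsmul_eq (x := j) (j / n)
    rwa [smul_eq_mul, mul_comm, ← Int.emod_def] at this
  rw [← hj]
  exact hi _ (Finset.mem_Ico.2 ⟨Int.emod_nonneg _ hn'.ne', Int.emod_lt_of_pos _ hn'⟩)

section PerStat

variable {n : ℕ} {a d : ℝ} {u v : ℤ → ℝ}

lemma perStat_le_one (hn : 0 < n) (ha : a ∈ Set.Ioo (0 : ℝ) 1) (hd : 0 < d)
    (hu : u ∈ PerStat n a d) (i : ℤ) : u i ≤ 1 := by
  obtain ⟨j, hj⟩ := exists_forall_le_of_periodic hn hu.1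
  refine (hj i).trans ?_
  by_contra! h
  have h1 := hu.2 j
  have h2 : g a (u j) < 0 :=
    mul_neg_of_neg_of_pos (mul_neg_of_pos_of_neg (by linarith) (by linarith))
      (by linarith [ha.2])
  have h3 : d * (u (j - 1) - 2 * u j + u (j + 1)) ≤ 0 :=
    mul_nonpos_of_nonneg_of_nonpos hd.le (by linarith [hj (j - 1), hj (j + 1)])
  linarith

lemma perStat_nonneg (hn : 0 < n) (ha : a ∈ Set.Ioo (0 : ℝ) 1) (hd : 0 < d)
    (hu : u ∈ PerStat n a d) (i : ℤ) : 0 ≤ u i := by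
  obtain ⟨j, hj⟩ := exists_forall_le_of_periodic (u := fun i => -u i) hn
    (fun i => congrArg Neg.neg (hu.1 i))
  simp only [neg_le_neg_iff] at hj
  refine le_trans ?_ (hj i)
  by_contra! h
  have h1 := hu.2 j
  have h2 : 0 < g a (u j) :=
    mul_pos_of_neg_of_neg (mul_neg_of_neg_of_pos h (by linarith)) (by linarith [ha.1])
  have h3 : 0 ≤ d * (u (j - 1) - 2 * u j + u (j + 1)) :=
    mul_nonneg hd.le (by linarith [hj (j - 1), hj (j + 1)])
  linarith

lemma abs_laplacian_le_two {x y z : ℝ} (hx : x ∈ Set.Icc (0 : ℝ) 1) (hy : y ∈ Set.Icc (0 : ℝ) 1)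
    (hz : z ∈ Set.Icc (0 : ℝ) 1) : |x - 2 * y + z| ≤ 2 := by
  obtain ⟨_, _⟩ := hx
  obtain ⟨_, _⟩ := hy
  obtain ⟨_, _⟩ := hz
  rw [abs_le]
  constructor <;> linarith

lemma abs_laplacian_le {x y z M : ℝ} (hx : |x| ≤ M) (hy : |y| ≤ M) (hz : |z| ≤ M) :
    |x - 2 * y + z| ≤ 4 * M := by
  rw [abs_le] at *
  constructor <;> linarith

lemma perStat_abs_sub_root_color_le (hn : 0 < n) (ha : a ∈ Set.Ioo (0 : ℝ) 1)
    (hd : d ∈ Set.Ioo 0 (radius a ^ 3 / 2)) (hu : u ∈ PerStat n a d) (i : ℤ) :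
    |u i - root a (color a (radius a) (u i))| ≤ radius a := by
  have hb : ∀ j, u j ∈ Set.Icc (0 : ℝ) 1 := fun j =>
    ⟨perStat_nonneg hn ha hd.1 hu j, perStat_le_one hn ha hd.1 hu j⟩
  apply abs_sub_root_color_le ha
  rw [eq_neg_of_add_eq_zero_right (hu.2 i), abs_neg, abs_mul, abs_of_pos hd.1]
  have := abs_laplacian_le_two (hb (i - 1)) (hb i) (hb (i + 1))
  calc d * |u (i - 1) - 2 * u i + u (i + 1)| ≤ d * 2 := by gcongr; exact hd.1.le
    _ < _ := by linarith [hd.2]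

lemma radius_cube_bounds (ha : a ∈ Set.Ioo (0 : ℝ) 1) :
    radius a ^ 3 / 2 ≤ radius a ∧ radius a ^ 3 / 2 ≤ 2 * radius a ^ 2 := by
  have h1 := radius_pos ha
  have h2 := radius_le a
  have h3 : radius a ^ 3 ≤ radius a ^ 2 := pow_le_pow_of_le_one h1.le (by linarith) (by norm_num)
  have h4 : radius a ^ 2 ≤ radius a ^ 1 :=
    pow_le_pow_of_le_one h1.le (by linarith) (by norm_num)
  rw [pow_one] at h4
  constructor <;> nlinarith

lemma perStat_eq_of_color_eq (hn : 0 < n) (ha : a ∈ Set.Ioo (0 : ℝ) 1)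
    (hd : d ∈ Set.Ioo 0 (radius a ^ 3 / 2)) (hu : u ∈ PerStat n a d) (hv : v ∈ PerStat n a d)
    (h : ∀ i, color a (radius a) (u i) = color a (radius a) (v i)) : u = v := by
  have hr := radius_pos ha
  obtain ⟨i, hi⟩ := exists_forall_le_of_periodic (u := fun i => |u i - v i|) hn
    (fun i => by rw [hu.1, hv.1])
  have hui := perStat_abs_sub_root_color_le hn ha hd hu i
  have hvi := perStat_abs_sub_root_color_le hn ha hd hv i
  rw [← h i] at hvi
  have h1 := abs_g_sub_g_sub_le ha hui hvi
  have h2 := le_abs_slope ha (color a (radius a) (u i))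
  set q := slope a (color a (radius a) (u i))
  have h3 : |q * (u i - v i)| ≤
      |g a (u i) - g a (v i)| + |g a (u i) - g a (v i) - q * (u i - v i)| := by
    have := abs_sub (g a (u i) - g a (v i)) (g a (u i) - g a (v i) - q * (u i - v i))
    rwa [sub_sub_cancel] at this
  have h4 : g a (u i) - g a (v i) =
      -(d * ((u (i - 1) - v (i - 1)) - 2 * (u i - v i) + (u (i + 1) - v (i + 1)))) := by
    linear_combination hu.2 i - hv.2 i
  have h5 : |g a (u i) - g a (v i)| ≤ d * (4 * |u i - v i|) := by
    rw [h4, abs_neg, abs_mul, abs_of_pos hd.1]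
    gcongr
    · exact hd.1.le
    · exact abs_laplacian_le (hi _) (hi _) (hi _)
  rw [abs_mul] at h3
  have h6 : 16 * radius a * |u i - v i| ≤ |q| * |u i - v i| := by gcongr
  have h7 := (radius_cube_bounds ha).1
  have h8 : |u i - v i| = 0 := by
    by_contra hne
    have hpos : 0 < |u i - v i| := lt_of_le_of_ne (abs_nonneg _) (Ne.symm hne)
    nlinarith [hd.2]
  funext j
  have := hi j
  simp only [h8] at this
  exact sub_eq_zero.1 (abs_nonpos_iff.1 this)

lemma exists_stationary_near_roots [NeZero n] (ha : a ∈ Set.Ioo (0 : ℝ) 1)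
    (hd : d ∈ Set.Ioo 0 (radius a ^ 3 / 2)) (s : ZMod n → Fin 3) :
    ∃ w : ZMod n → ℝ, (∀ i, d * (w (i - 1) - 2 * w i + w (i + 1)) + g a (w i) = 0) ∧
      ∀ i, |w i - root a (s i)| ≤ radius a := by
  have hr := radius_pos ha
  have hdr := radius_cube_bounds ha
  have hq : ∀ i, 0 < |slope a (s i)| := fun i => by linarith [le_abs_slope ha (s i)]
  have hq0 : ∀ i, slope a (s i) ≠ 0 := fun i => abs_pos.1 (hq i)
  let T : (ZMod n → ℝ) → (ZMod n → ℝ) := fun w i =>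
    w i - (d * (w (i - 1) - 2 * w i + w (i + 1)) + g a (w i)) / slope a (s i)
  let P : ZMod n → ℝ := fun i => root a (s i)
  have hball : ∀ w, w ∈ Metric.closedBall P (radius a) → ∀ i, |w i - root a (s i)| ≤ radius a := by
    intro w hw i
    have := (dist_pi_le_iff hr.le).1 (Metric.mem_closedBall.1 hw) i
    rwa [Real.dist_eq] at this
  have hP : P ∈ Metric.closedBall P (radius a) := Metric.mem_closedBall_self hr.le
  have hT : ∀ w ∈ Metric.closedBall P (radius a), ∀ z ∈ Metric.closedBall P (radius a),
      dist (T w) (T z) ≤ 3 / 4 * dist w z := by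
    intro w hw z hz
    refine (dist_pi_le_iff (by positivity)).2 fun i => ?_
    have hD : ∀ j, |w j - z j| ≤ dist w z := fun j => by
      rw [← Real.dist_eq]; exact dist_le_pi_dist w z j
    have h1 := abs_g_sub_g_sub_le ha (hball w hw i) (hball z hz i)
    have h2 := abs_laplacian_le (hD (i - 1)) (hD i) (hD (i + 1))
    have h3 : T w i - T z i = -((g a (w i) - g a (z i) - slope a (s i) * (w i - z i)) +
        d * ((w (i - 1) - z (i - 1)) - 2 * (w i - z i) + (w (i + 1) - z (i + 1)))) /
          slope a (s i) := by
      simp only [T]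
      field_simp [hq0 i]
      ring
    rw [Real.dist_eq, h3, abs_div, abs_neg, div_le_iff₀ (hq i)]
    refine (abs_add_le _ _).trans ?_
    rw [abs_mul d, abs_of_pos hd.1]
    have h4 : d * |(w (i - 1) - z (i - 1)) - 2 * (w i - z i) + (w (i + 1) - z (i + 1))| ≤
        radius a * (4 * dist w z) := by
      have := hd.2
      gcongr
      linarith
    have h5 : 8 * radius a * |w i - z i| ≤ 8 * radius a * dist w z := by gcongr; exact hD i
    have h6 : 3 / 4 * dist w z * (16 * radius a) ≤ 3 / 4 * dist w z * |slope a (s i)| := by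
      gcongr; exact le_abs_slope ha (s i)
    linarith
  have hTP : dist (T P) P ≤ 1 / 4 * radius a := by
    refine (dist_pi_le_iff (by positivity)).2 fun i => ?_
    have h1 := abs_laplacian_le_two (root_mem_Icc ha (s (i - 1))) (root_mem_Icc ha (s i))
      (root_mem_Icc ha (s (i + 1)))
    have h3 : T P i - P i = -(d * (root a (s (i - 1)) - 2 * root a (s i) + root a (s (i + 1)))) /
        slope a (s i) := by
      simp only [T, P, g_root]
      ring
    rw [Real.dist_eq, h3, abs_div, abs_neg, div_le_iff₀ (hq i), abs_mul, abs_of_pos hd.1]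
    have h4 : d * |root a (s (i - 1)) - 2 * root a (s i) + root a (s (i + 1))| ≤
        (2 * radius a ^ 2) * 2 := by
      have := hd.2
      gcongr
      linarith
    have h6 : 1 / 4 * radius a * (16 * radius a) ≤ 1 / 4 * radius a * |slope a (s i)| := by
      gcongr; exact le_abs_slope ha (s i)
    linarith
  have hmaps : Set.MapsTo T (Metric.closedBall P (radius a)) (Metric.closedBall P (radius a)) := by
    intro w hw
    have h1 := hT w hw P hP
    have h2 := dist_triangle (T w) (T P) P
    have h3 := Metric.mem_closedBall.1 hw
    rw [Metric.mem_closedBall]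
    linarith
  have hc : ContractingWith (3 / 4) (hmaps.restrict T _ _) := by
    refine ⟨by rw [← NNReal.coe_lt_coe]; norm_num, LipschitzWith.of_dist_le_mul fun w z => ?_⟩
    simpa [Subtype.dist_eq] using hT w.1 w.2 z.1 z.2
  obtain ⟨w, hw, hfix, -⟩ := hc.exists_fixedPoint' Metric.isClosed_closedBall.isComplete hmaps hP
    (edist_ne_top _ _)
  refine ⟨w, fun i => ?_, hball w hw⟩
  have := congrFun hfix i
  simp only [T, sub_eq_self, div_eq_zero_iff, hq0 i, or_false] at this
  exact this

lemma exists_zmod_lift [NeZero n] {α : Type*} {s : ℤ → α} (hs : Function.Periodic s (n : ℤ)) :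
    ∃ f : ZMod n → α, ∀ i : ℤ, f i = s i := by
  refine ⟨fun x => s x.val, fun i => ?_⟩
  have := hs.sub_zsmul_eq (x := i) (i / n)
  rw [smul_eq_mul, mul_comm, ← Int.emod_def] at this
  rw [← this, ← ZMod.val_intCast]

lemma color_bijOn (hn : 0 < n) (ha : a ∈ Set.Ioo (0 : ℝ) 1)
    (hd : d ∈ Set.Ioo 0 (radius a ^ 3 / 2)) :
    Set.BijOn (fun u => color a (radius a) ∘ u) (PerStat n a d)
      {s : ℤ → Fin 3 | Function.Periodic s (n : ℤ)} := by
  have : NeZero n := ⟨hn.ne'⟩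
  refine ⟨fun u hu i => congrArg (color a (radius a)) (hu.1 i),
    fun u hu v hv h => perStat_eq_of_color_eq hn ha hd hu hv (congrFun h), fun s hs => ?_⟩
  obtain ⟨f, hf⟩ := exists_zmod_lift hs
  obtain ⟨w, hw, hws⟩ := exists_stationary_near_roots ha hd f
  refine ⟨fun i => w i, ⟨fun i => by simp, fun i => ?_⟩, funext fun i => ?_⟩
  · simpa using hw i
  · rw [← hf i]
    exact color_eq_of_abs_sub_root_le ha (hws i)

end PerStat

/-- Cyclic words of length `n` over the alphabet `α`. -/
def Word (n : ℕ) (α : Type*) : Type _ := ZMod n → α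

namespace Word

variable {n : ℕ} {α : Type*}

/-- The action of the dihedral group on cyclic words. -/
def act : DihedralGroup n → Word n α → Word n α
  | .r i, f => fun x => f (x + i)
  | .sr i, f => fun x => f (i - x)

instance : MulAction (DihedralGroup n) (Word n α) where
  smul := act
  one_smul f := funext fun x => congrArg f (add_zero x)
  mul_smul := by
    rintro (i | i) (j | j) f <;> funext x
    · exact congrArg f (by ring : x + (i + j) = x + i + j)
    · exact congrArg f (by ring : j - i - x = j - (x + i))
    · exact congrArg f (by ring : i + j - x = i - x + j)
    · exact congrArg f (by ring : x + (j - i) = j - (i - x))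

end Word

/-- Functions on a finite additive group invariant under a translation. -/
lemma card_translation_invariant {A α : Type*} [AddCommGroup A] [Finite A] (i : A) :
    Nat.card {f : A → α | ∀ x, f (x + i) = f x} =
      Nat.card α ^ (Nat.card A / addOrderOf i) := by
  have e : {f : A → α | ∀ x, f (x + i) = f x} ≃ (A ⧸ AddSubgroup.zmultiples i → α) :=
    { toFun := fun f => fun q => Quotient.liftOn' q f.1 (by
        intro x y hxy
        rw [QuotientAddGroup.leftRel_apply, AddSubgroup.mem_zmultiples_iff] at hxy
        obtain ⟨k, hk⟩ := hxy
        have hp : Function.Periodic f.1 i := f.2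
        rw [← hp.zsmul k x, hk, add_neg_cancel_left])
      invFun := fun h => ⟨fun x => h x, fun x => by
        exact congrArg h (QuotientAddGroup.eq.2 (by simp))⟩
      left_inv := fun f => rfl
      right_inv := fun h => funext fun q => by
        induction q using QuotientAddGroup.induction_on
        rfl }
  have hc := AddSubgroup.card_eq_card_quotient_mul_card_addSubgroup (AddSubgroup.zmultiples i)
  rw [Nat.card_zmultiples] at hc
  rw [Nat.card_congr e, Nat.card_fun, hc, Nat.mul_div_cancel _ (addOrderOf_pos i)]

/-- Functions invariant under an involution. -/
lemma card_involution_invariant {X α : Type*} [LinearOrder X] [Fintype X] {σ : X → X}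
    (hσ : Function.Involutive σ) :
    ∃ m, 2 * m = Fintype.card X + (Finset.univ.filter fun x => σ x = x).card ∧
      Nat.card {f : X → α | ∀ x, f (σ x) = f x} = Nat.card α ^ m := by
  refine ⟨(Finset.univ.filter fun x => x ≤ σ x).card, ?_, ?_⟩
  · have h1 : (Finset.univ.filter fun x => x ≤ σ x).card =
        (Finset.univ.filter fun x => σ x ≤ x).card :=
      Finset.card_bij' (fun x _ => σ x) (fun x _ => σ x) (by simp [hσ _]) (by simp [hσ _])
        (by simp [hσ _]) (by simp [hσ _])
    have h2 := Finset.card_union_add_card_inter (Finset.univ.filter fun x => x ≤ σ x)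
      (Finset.univ.filter fun x => σ x ≤ x)
    rw [← Finset.filter_or, ← Finset.filter_and, ← h1] at h2
    have h3 : (Finset.univ.filter fun x => x ≤ σ x ∨ σ x ≤ x) = Finset.univ := by
      simp [le_total]
    have h4 : (Finset.univ.filter fun x => x ≤ σ x ∧ σ x ≤ x) =
        Finset.univ.filter fun x => σ x = x := by
      ext x
      simp [le_antisymm_iff, and_comm]
    rw [h3, h4, Finset.card_univ] at h2
    omega
  · have e : {f : X → α | ∀ x, f (σ x) = f x} ≃ ({x // x ≤ σ x} → α) :=
      { toFun := fun f x => f.1 x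
        invFun := fun h => ⟨fun x => if hx : x ≤ σ x then h ⟨x, hx⟩
            else h ⟨σ x, by rw [hσ]; exact (not_le.1 hx).le⟩, fun x => by
          rcases lt_trichotomy x (σ x) with hx | hx | hx
          · have hx' : ¬ σ x ≤ σ (σ x) := by rw [hσ]; exact hx.not_ge
            beta_reduce
            rw [dif_neg hx', dif_pos hx.le]
            simp only [hσ x]
          · simp only [← hx]
          · have hx' : σ x ≤ σ (σ x) := by rw [hσ]; exact hx.le
            simp only [hx.not_ge, hx', dite_true, dite_false]⟩
        left_inv := fun f => Subtype.ext <| funext fun x => by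
          by_cases hx : x ≤ σ x
          · simp only [hx, dite_true]
          · simp only [hx, dite_false]
            exact f.2 x
        right_inv := fun h => funext fun x => by simp [x.2] }
    rw [Nat.card_congr e, Nat.card_fun, Nat.card_eq_fintype_card (α := {x // x ≤ σ x}),
      Fintype.card_subtype]

section Reflections

variable (n : ℕ) [NeZero n]

lemma card_reflection_fixed (j : ZMod n) :
    (Finset.univ.filter fun x : ZMod n => j - x = x).card = 0 ∨
      (Finset.univ.filter fun x : ZMod n => j - x = x).card = n.gcd 2 := by
  rcases (Finset.univ.filter fun x : ZMod n => j - x = x).eq_empty_or_nonempty with h | ⟨y, hy⟩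
  · exact Or.inl (by rw [h, Finset.card_empty])
  · right
    have hk := IsAddCyclic.card_nsmulAddMonoidHom_ker (ZMod n) 2
    rw [Nat.card_zmod] at hk
    rw [Finset.mem_filter_univ, sub_eq_iff_eq_add] at hy
    rw [← hk, ← Fintype.card_subtype, ← Nat.card_eq_fintype_card]
    refine Nat.card_congr ((Equiv.subRight y).subtypeEquiv fun x => ?_)
    simp only [AddMonoidHom.mem_ker, nsmulAddMonoidHom_apply, Equiv.subRight_apply, hy]
    constructor <;> intro h <;> linear_combination -h

lemma sum_card_reflection_fixed :
    ∑ j : ZMod n, (Finset.univ.filter fun x : ZMod n => j - x = x).card = n := by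
  have := Finset.card_eq_sum_card_fiberwise (f := fun x : ZMod n => x + x)
    (s := Finset.univ) (t := Finset.univ) (fun _ _ => Finset.mem_univ _)
  rw [Finset.card_univ, ZMod.card] at this
  conv_rhs => rw [this]
  refine Finset.sum_congr rfl fun j _ => congrArg _ (Finset.filter_congr fun x _ => ?_)
  rw [sub_eq_iff_eq_add, eq_comm]

lemma sum_card_reflection_invariant (k : ℕ) :
    ∑ j : ZMod n, (Nat.card {f : ZMod n → Fin k | ∀ x, f (j - x) = f x} : ℚ) =
      if Even n then n * (((k : ℚ) + 1) / 2 * (k : ℚ) ^ (n / 2))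
      else n * (k : ℚ) ^ ((n + 1) / 2) := by
  let _ : LinearOrder (ZMod n) := LinearOrder.lift' ZMod.val (ZMod.val_injective n)
  choose m hm hcard using fun j : ZMod n =>
    card_involution_invariant (α := Fin k) (σ := fun x : ZMod n => j - x)
      (fun x => sub_sub_cancel j x)
  simp only [ZMod.card] at hm
  simp only [hcard, Nat.card_fin]
  have hsum := sum_card_reflection_fixed n
  set F : ZMod n → ℕ := fun j => (Finset.univ.filter fun x : ZMod n => j - x = x).card
  have hF : ∀ j, F j = 0 ∨ F j = n.gcd 2 := card_reflection_fixed n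
  have hm' : ∀ j, 2 * m j = n + F j := fun j => by convert hm j
  have hsum' : ∑ j, (F j : ℚ) = n := by exact_mod_cast hsum
  split_ifs with he
  · obtain ⟨l, rfl⟩ := he
    have hg : (l + l).gcd 2 = 2 := Nat.gcd_eq_right ⟨l, by ring⟩
    have hterm : ∀ j, ((k ^ m j : ℕ) : ℚ) = (k : ℚ) ^ l * (1 + (k - 1) * (F j / 2)) := by
      intro j
      have := hm' j
      rcases hF j with h | h
      · rw [h, show m j = l by omega]
        push_cast
        ring
      · rw [hg] at h
        rw [h, show m j = l + 1 by omega]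
        push_cast
        ring
    simp only [hterm, ← Finset.mul_sum, Finset.sum_add_distrib, ← Finset.sum_div, hsum']
    rw [show (l + l) / 2 = l by omega]
    simp
    ring
  · have ho : n.gcd 2 = 1 := Nat.Coprime.symm ((Nat.coprime_two_left).2 (Nat.not_even_iff_odd.1 he))
    rw [ho] at hF
    have hone : ∀ j, m j = (n + 1) / 2 := by
      intro j
      have h1 := hm' j
      rw [Nat.not_even_iff] at he
      rcases hF j with h | h <;> omega
    simp [hone]

end Reflections

lemma sum_card_rotation_invariant (n k : ℕ) [NeZero n] :
    ∑ i : ZMod n, (Nat.card {f : ZMod n → Fin k | ∀ x, f (x + i) = f x} : ℚ) = n * Nq k n := by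
  have hn : (n : ℚ) ≠ 0 := Nat.cast_ne_zero.2 (NeZero.ne n)
  simp only [card_translation_invariant, Nat.card_fin, Nat.card_zmod]
  rw [Nq, ← mul_assoc, mul_one_div_cancel hn, one_mul,
    ← Finset.sum_fiberwise_of_maps_to (s := Finset.univ) (t := n.divisors) (g := addOrderOf)
      (fun i _ => Nat.mem_divisors.2 ⟨by simpa using addOrderOf_dvd_card (x := i), NeZero.ne n⟩)]
  refine Finset.sum_congr rfl fun e he => ?_
  rw [Finset.sum_congr rfl (g := fun _ => ((k ^ (n / e) : ℕ) : ℚ))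
    (fun i hi => by rw [(Finset.mem_filter.1 hi).2]), Finset.sum_const, nsmul_eq_mul,
    IsAddCyclic.card_addOrderOf_eq_totient (by simpa using Nat.dvd_of_mem_divisors he)]
  push_cast
  rfl

instance {n : ℕ} [NeZero n] {α : Type*} [Finite α] : Finite (Word n α) :=
  inferInstanceAs (Finite (ZMod n → α))

lemma card_dihedral_orbits (n k : ℕ) [NeZero n] :
    (Nat.card (MulAction.orbitRel.Quotient (DihedralGroup n) (Word n (Fin k))) : ℚ) = Bq k n := by
  classical
  have hn : (n : ℚ) ≠ 0 := Nat.cast_ne_zero.2 (NeZero.ne n)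
  have := Fintype.ofFinite (Word n (Fin k))
  have := Fintype.ofFinite (MulAction.orbitRel.Quotient (DihedralGroup n) (Word n (Fin k)))
  have hB := MulAction.sum_card_fixedBy_eq_card_orbits_mul_card_group
    (DihedralGroup n) (Word n (Fin k))
  rw [DihedralGroup.card, ← DihedralGroup.equivSum.symm.sum_comp, Fintype.sum_sum_type] at hB
  simp only [← Nat.card_eq_fintype_card] at hB
  have hr : ∀ i : ZMod n, MulAction.fixedBy (Word n (Fin k)) (DihedralGroup.r i) =
      {f : ZMod n → Fin k | ∀ x, f (x + i) = f x} := fun i => Set.ext fun f => funext_iff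
  have hs : ∀ i : ZMod n, MulAction.fixedBy (Word n (Fin k)) (DihedralGroup.sr i) =
      {f : ZMod n → Fin k | ∀ x, f (i - x) = f x} := fun i => Set.ext fun f => funext_iff
  have hB' : ∑ i : ZMod n, (Nat.card {f : ZMod n → Fin k | ∀ x, f (x + i) = f x} : ℚ) +
      ∑ i : ZMod n, (Nat.card {f : ZMod n → Fin k | ∀ x, f (i - x) = f x} : ℚ) =
      (Nat.card (MulAction.orbitRel.Quotient (DihedralGroup n) (Word n (Fin k))) : ℚ) *
        (2 * n) := by
    simp only [← hr, ← hs]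
    exact_mod_cast hB
  rw [sum_card_rotation_invariant, sum_card_reflection_invariant] at hB'
  rw [← mul_left_inj' (mul_ne_zero two_ne_zero hn), ← hB', Bq]
  split_ifs <;> ring

section Sequences

variable {α : Type*}

/-- The shift of a bi-infinite sequence. -/
def shift (s : ℤ → α) : ℤ → α := fun i => s (i + 1)

lemma shift_iterate (m : ℕ) (s : ℤ → α) : shift^[m] s = fun i => s (i + m) := by
  induction m with
  | zero => simp
  | succ m ih =>
    rw [Function.iterate_succ_apply', ih]
    funext i
    simp only [shift]
    congr 1
    push_cast
    ring

lemma isPeriodicPt_shift_iff {m : ℕ} {s : ℤ → α} :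
    Function.IsPeriodicPt shift m s ↔ ∀ i : ℤ, s (i + m) = s i := by
  rw [Function.IsPeriodicPt, Function.IsFixedPt, shift_iterate, funext_iff]

lemma minPeriodExact_iff {n : ℕ} (hn : 0 < n) {u : ℤ → ℝ} :
    MinPeriodExact n u ↔ Function.minimalPeriod shift u = n := by
  simp only [MinPeriodExact, ← isPeriodicPt_shift_iff]
  constructor
  · rintro ⟨h1, h2⟩
    exact le_antisymm (h1.minimalPeriod_le hn)
      (h2 _ (h1.minimalPeriod_pos hn) (Function.isPeriodicPt_minimalPeriod _ _))
  · rintro rfl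
    exact ⟨Function.isPeriodicPt_minimalPeriod _ _, fun m hm h => h.minimalPeriod_le hm⟩

/-- Two sequences are equivalent if they differ by an isometry of `ℤ`. -/
def seqSetoid (α : Type*) : Setoid (ℤ → α) where
  r s t := (∃ l : ℤ, ∀ i, t i = s (i + l)) ∨ ∃ l : ℤ, ∀ i, t i = s (l - i)
  iseqv :=
    { refl := fun s => Or.inl ⟨0, fun i => by rw [add_zero]⟩
      symm := by
        rintro s t (⟨l, h⟩ | ⟨l, h⟩)
        · exact Or.inl ⟨-l, fun i => by rw [h, neg_add_cancel_right]⟩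
        · exact Or.inr ⟨l, fun i => by rw [h, sub_sub_cancel]⟩
      trans := by
        rintro s t w (⟨l, h⟩ | ⟨l, h⟩) (⟨m, h'⟩ | ⟨m, h'⟩)
        · exact Or.inl ⟨m + l, fun i => by rw [h', h, add_assoc]⟩
        · exact Or.inr ⟨m + l, fun i => by rw [h', h, sub_add_eq_add_sub]⟩
        · exact Or.inr ⟨l - m, fun i => by rw [h', h, sub_add_eq_sub_sub_swap]⟩
        · exact Or.inl ⟨l - m, fun i => by rw [h', h]; congr 1; ring⟩ }

lemma minimalPeriod_eq_of_equiv {s t : ℤ → α} (h : seqSetoid α s t) :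
    Function.minimalPeriod shift s = Function.minimalPeriod shift t := by
  have key : ∀ {s t : ℤ → α}, seqSetoid α s t → ∀ {m : ℕ},
      Function.IsPeriodicPt shift m s → Function.IsPeriodicPt shift m t := by
    intro s t h m hs
    rw [isPeriodicPt_shift_iff] at hs ⊢
    rcases h with ⟨l, h⟩ | ⟨l, h⟩ <;> intro i <;> rw [h, h]
    · rw [add_right_comm, hs]
    · rw [← hs (l - (i + m)), sub_add_eq_sub_sub, sub_add_cancel]
  exact Function.minimalPeriod_eq_minimalPeriod_iff.2 fun m =>
    ⟨key h, key ((seqSetoid α).symm h)⟩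

/-- The minimal period of a class of sequences (`0` for non-periodic sequences). -/
noncomputable def orbitPeriod : Quotient (seqSetoid α) → ℕ :=
  Quotient.lift (Function.minimalPeriod shift) fun _ _ h => minimalPeriod_eq_of_equiv h

lemma ncard_orbitPeriod_dvd (n : ℕ) [NeZero n] :
    {o : Quotient (seqSetoid α) | orbitPeriod o ∣ n}.ncard =
      Nat.card (MulAction.orbitRel.Quotient (DihedralGroup n) (Word n α)) := by
  let F : MulAction.orbitRel.Quotient (DihedralGroup n) (Word n α) → Quotient (seqSetoid α) :=
    Quotient.lift (fun f : Word n α => Quotient.mk (seqSetoid α) fun i : ℤ => f i) (by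
      rintro f f' ⟨(l | l), rfl⟩
      all_goals
        refine Quotient.sound ((seqSetoid α).symm ?_)
        obtain ⟨l, rfl⟩ := ZMod.intCast_surjective l
      · exact Or.inl ⟨l, fun i => by push_cast; rfl⟩
      · exact Or.inr ⟨l, fun i => by push_cast; rfl⟩)
  have hF : Function.Injective F := by
    intro o o'
    induction o using Quotient.inductionOn with | _ f
    induction o' using Quotient.inductionOn with | _ f'
    intro h
    refine Quotient.sound ((MulAction.orbitRel (DihedralGroup n) (Word n α)).symm ?_)
    rcases Quotient.exact h with ⟨l, h⟩ | ⟨l, h⟩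
    · refine ⟨DihedralGroup.r l, funext fun x => ?_⟩
      obtain ⟨i, rfl⟩ := ZMod.intCast_surjective x
      exact (congrArg f (by push_cast; rfl)).trans (h i).symm
    · refine ⟨DihedralGroup.sr l, funext fun x => ?_⟩
      obtain ⟨i, rfl⟩ := ZMod.intCast_surjective x
      exact (congrArg f (by push_cast; rfl)).trans (h i).symm
  have hrange : Set.range F = {o | orbitPeriod o ∣ n} := by
    ext o
    constructor
    · rintro ⟨q, rfl⟩
      induction q using Quotient.inductionOn with | _ f
      exact (isPeriodicPt_shift_iff.2 fun i => congrArg f (by simp)).minimalPeriod_dvd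
    · induction o using Quotient.inductionOn with | _ s
      intro h
      have hs := isPeriodicPt_shift_iff.1 (Function.isPeriodicPt_iff_minimalPeriod_dvd.2 h)
      obtain ⟨f, hf⟩ := exists_zmod_lift (s := s) hs
      exact ⟨Quotient.mk _ f, congrArg (Quotient.mk (seqSetoid α)) (funext hf)⟩
  rw [← hrange, ← Set.image_univ, Set.ncard_image_of_injective _ hF, Set.ncard_univ]

lemma finite_orbitPeriod_dvd [Finite α] (n : ℕ) [NeZero n] :
    {o : Quotient (seqSetoid α) | orbitPeriod o ∣ n}.Finite := by
  cases isEmpty_or_nonempty α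
  · have : IsEmpty (Quotient (seqSetoid α)) := ⟨fun o => o.inductionOn fun s => isEmptyElim (s 0)⟩
    exact Set.toFinite _
  · apply Set.finite_of_ncard_ne_zero
    rw [ncard_orbitPeriod_dvd]
    have : Nonempty (MulAction.orbitRel.Quotient (DihedralGroup n) (Word n α)) :=
      ⟨Quotient.mk _ fun _ => Classical.arbitrary α⟩
    exact Nat.card_pos.ne'

lemma ncard_orbitPeriod_dvd_eq_Bq (k : ℕ) {n : ℕ} (hn : 0 < n) :
    ({o : Quotient (seqSetoid (Fin k)) | orbitPeriod o ∣ n}.ncard : ℚ) = Bq k n := by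
  have : NeZero n := ⟨hn.ne'⟩
  rw [ncard_orbitPeriod_dvd, card_dihedral_orbits]

lemma ncard_orbitPeriod_eq (k : ℕ) {n : ℕ} (hn : 0 < n) :
    ({o : Quotient (seqSetoid (Fin k)) | orbitPeriod o = n}.ncard : ℚ) = BLq k n := by
  have hsum : ∀ m > 0, ∑ e ∈ m.divisors,
      ({o : Quotient (seqSetoid (Fin k)) | orbitPeriod o = e}.ncard : ℚ) = Bq k m := by
    intro m hm
    have : NeZero m := ⟨hm.ne'⟩
    have hfin := finite_orbitPeriod_dvd (α := Fin k) m
    rw [← ncard_orbitPeriod_dvd_eq_Bq k hm, Set.ncard_eq_toFinset_card _ hfin,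
      Finset.card_eq_sum_card_fiberwise (f := orbitPeriod) (t := m.divisors)
        (fun o ho => Finset.mem_coe.2 (Nat.mem_divisors.2
          ⟨hfin.mem_toFinset.1 (Finset.mem_coe.1 ho), hm.ne'⟩))]
    push_cast
    refine Finset.sum_congr rfl fun e he => ?_
    rw [← Set.ncard_coe_finset]
    congr 2
    ext o
    simp only [Set.mem_ofPred_eq, Finset.coe_filter, Set.Finite.mem_toFinset]
    exact ⟨fun h => ⟨h ▸ Nat.dvd_of_mem_divisors he, h⟩, And.right⟩
  have := ArithmeticFunction.sum_eq_iff_sum_mul_moebius_eq.1 hsum n hn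
  rw [← this, BLq, Nat.sum_divisorsAntidiagonal
    (f := fun x y => (ArithmeticFunction.moebius x : ℚ) * Bq k y)]

lemma ncard_periodic (k : ℕ) {n : ℕ} (hn : 0 < n) :
    {s : ℤ → Fin k | Function.Periodic s (n : ℤ)}.ncard = k ^ n := by
  have : NeZero n := ⟨hn.ne'⟩
  let F : (ZMod n → Fin k) → (ℤ → Fin k) := fun f i => f i
  have hF : Function.Injective F := fun f f' h => funext fun x => by
    obtain ⟨i, rfl⟩ := ZMod.intCast_surjective x
    exact congrFun h i
  have hrange : Set.range F = {s | Function.Periodic s (n : ℤ)} := by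
    ext s
    constructor
    · rintro ⟨f, rfl⟩ i
      exact congrArg f (by simp)
    · intro hs
      obtain ⟨f, hf⟩ := exists_zmod_lift hs
      exact ⟨f, funext hf⟩
  rw [← hrange, ← Set.image_univ, Set.ncard_image_of_injective _ hF, Set.ncard_univ]
  simp

end Sequences

section Orbits

variable {n : ℕ} {a d : ℝ}

lemma translate_mem_perStat {u : ℤ → ℝ} (hu : u ∈ PerStat n a d) (l : ℤ) :
    (fun i : ℤ => u (i + l)) ∈ PerStat n a d := by
  refine ⟨fun i => ?_, fun i => ?_⟩
  · beta_reduce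
    rw [add_right_comm]
    exact hu.1 _
  · have := hu.2 (i + l)
    rwa [← sub_add_eq_add_sub, add_right_comm] at this

lemma reflect_mem_perStat {u : ℤ → ℝ} (hu : u ∈ PerStat n a d) :
    (fun i : ℤ => u (1 - i)) ∈ PerStat n a d := by
  refine ⟨fun i => ?_, fun i => ?_⟩
  · beta_reduce
    rw [← hu.1 (1 - (i + n))]
    congr 1
    ring
  · have := hu.2 (1 - i)
    beta_reduce
    rw [show 1 - (i - 1) = 1 - i + 1 by ring, show 1 - (i + 1) = 1 - i - 1 by ring]
    linarith

lemma quot_mk_translate (u : PerStat n a d) (l : ℤ) :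
    Quot.mk (DihSeqRel n a d) ⟨_, translate_mem_perStat u.2 l⟩ = Quot.mk _ u := by
  have hstep : ∀ l : ℤ, Quot.mk (DihSeqRel n a d) ⟨_, translate_mem_perStat u.2 l⟩ =
      Quot.mk (DihSeqRel n a d) ⟨_, translate_mem_perStat u.2 (l + 1)⟩ := fun l =>
    Quot.sound (Or.inl fun i => congrArg u.1 (by ring))
  induction l using Int.induction_on with
  | zero => exact congrArg _ (Subtype.ext (funext fun i => congrArg u.1 (add_zero i)))
  | succ l ih => rw [← hstep, ih]
  | pred l ih =>
    rw [hstep]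
    simpa only [sub_add_cancel] using ih

lemma quot_mk_eq_of_equiv {u v : PerStat n a d} (h : seqSetoid ℝ u.1 v.1) :
    Quot.mk (DihSeqRel n a d) u = Quot.mk _ v := by
  rcases h with ⟨l, h⟩ | ⟨l, h⟩
  · rw [← quot_mk_translate u l]
    exact congrArg _ (Subtype.ext (funext fun i => (h i).symm))
  · have h1 : Quot.mk (DihSeqRel n a d) u = Quot.mk _ ⟨_, reflect_mem_perStat u.2⟩ :=
      Quot.sound (Or.inr fun i => rfl)
    rw [h1, ← quot_mk_translate _ (1 - l)]
    refine congrArg _ (Subtype.ext (funext fun i => ?_))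
    rw [h]
    exact congrArg u.1 (by ring)

variable {c : ℝ → Fin 3}

lemma equiv_of_comp_equiv (hc : Set.InjOn (fun u => c ∘ u) (PerStat n a d)) {u v : ℤ → ℝ}
    (hu : u ∈ PerStat n a d) (hv : v ∈ PerStat n a d)
    (h : seqSetoid (Fin 3) (c ∘ u) (c ∘ v)) : seqSetoid ℝ u v := by
  rcases h with ⟨l, h⟩ | ⟨l, h⟩
  · exact Or.inl ⟨l, congrFun (hc hv (translate_mem_perStat hu l) (funext h))⟩
  · refine Or.inr ⟨l, congrFun (hc hv (?_ : (fun i => u (l - i)) ∈ _) (funext h))⟩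
    have := translate_mem_perStat (reflect_mem_perStat hu) (1 - l)
    convert this using 3
    ring

lemma comp_equiv {α β : Type*} (c : α → β) {u v : ℤ → α} (h : seqSetoid α u v) :
    seqSetoid β (c ∘ u) (c ∘ v) :=
  h.imp (Exists.imp fun _ h i => congrArg c (h i)) (Exists.imp fun _ h i => congrArg c (h i))

lemma minimalPeriod_comp (hc : Set.InjOn (fun u => c ∘ u) (PerStat n a d)) {u : ℤ → ℝ}
    (hu : u ∈ PerStat n a d) :
    Function.minimalPeriod shift (c ∘ u) = Function.minimalPeriod shift u := by
  refine Function.minimalPeriod_eq_minimalPeriod_iff.2 fun m => ?_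
  simp only [isPeriodicPt_shift_iff]
  exact ⟨fun h => congrFun (hc (translate_mem_perStat hu m) hu (funext h)),
    fun h i => congrArg c (h i)⟩

/-- The map from orbits of stationary solutions to classes of colour sequences. -/
def orbitColor (n : ℕ) (a d : ℝ) (c : ℝ → Fin 3) :
    Quot (DihSeqRel n a d) → Quotient (seqSetoid (Fin 3)) :=
  Quot.lift (fun u => Quotient.mk _ (c ∘ u.1)) fun _ _ h =>
    Quotient.sound (comp_equiv c (h.imp (fun h => ⟨1, h⟩) fun h => ⟨1, h⟩))

lemma orbitColor_injective (hc : Set.InjOn (fun u => c ∘ u) (PerStat n a d)) :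
    Function.Injective (orbitColor n a d c) := by
  rintro ⟨u⟩ ⟨v⟩ h
  exact quot_mk_eq_of_equiv (equiv_of_comp_equiv hc u.2 v.2 (Quotient.exact h))

lemma orbitColor_range (hc : Set.BijOn (fun u => c ∘ u) (PerStat n a d)
    {s : ℤ → Fin 3 | Function.Periodic s (n : ℤ)}) :
    Set.range (orbitColor n a d c) = {o | orbitPeriod o ∣ n} := by
  ext o
  constructor
  · rintro ⟨⟨u⟩, rfl⟩
    exact (isPeriodicPt_shift_iff.2 (hc.mapsTo u.2)).minimalPeriod_dvd
  · induction o using Quotient.inductionOn with | _ s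
    intro h
    obtain ⟨u, hu, rfl⟩ := hc.surjOn
      (isPeriodicPt_shift_iff.1 (Function.isPeriodicPt_iff_minimalPeriod_dvd.2 h))
    exact ⟨Quot.mk _ ⟨u, hu⟩, rfl⟩

lemma orbitColor_image_minPeriodExact (hn : 0 < n)
    (hc : Set.BijOn (fun u => c ∘ u) (PerStat n a d)
      {s : ℤ → Fin 3 | Function.Periodic s (n : ℤ)}) :
    orbitColor n a d c '' {o | ∀ u : PerStat n a d, Quot.mk (DihSeqRel n a d) u = o →
      MinPeriodExact n (u : ℤ → ℝ)} = {o | orbitPeriod o = n} := by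
  ext o
  constructor
  · rintro ⟨⟨u⟩, h, rfl⟩
    exact (minimalPeriod_comp hc.injOn u.2).trans ((minPeriodExact_iff hn).1 (h u rfl))
  · intro h
    obtain ⟨q, rfl⟩ : o ∈ Set.range (orbitColor n a d c) := by
      rw [orbitColor_range hc]
      exact Dvd.intro_left 1 (by rw [one_mul]; exact h)
    refine ⟨q, ?_, rfl⟩
    rintro u rfl
    exact (minPeriodExact_iff hn).2 ((minimalPeriod_comp hc.injOn u.2).symm.trans h)

end Orbits

end Nagumo

/-- For `n ≥ 3`, `a ∈ (0,1)` and all small `d > 0`: the lattice Nagumo equation has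
exactly `3ⁿ` `n`-periodic stationary solutions, the set of these solutions is invariant
under translations and reflection, the number of orbits of the dihedral action is
`B₃(n)`, and exactly `BL₃(n) = ∑_{d'∣n} μ(d') B₃(n/d')` of these orbits consist of
solutions of minimal period exactly `n`. -/
theorem periodic_solution_bracelet_count
    (n : ℕ) (hn : 3 ≤ n) (a : ℝ) (ha : a ∈ Set.Ioo (0:ℝ) 1) :
    ∃ d0 > (0:ℝ), ∀ d ∈ Set.Ioo (0:ℝ) d0,
      (PerStat n a d).ncard = 3 ^ n ∧
      (∀ u ∈ PerStat n a d, ∀ ℓ : ℤ, (fun i : ℤ => u (i + ℓ)) ∈ PerStat n a d) ∧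
      (∀ u ∈ PerStat n a d, (fun i : ℤ => u (1 - i)) ∈ PerStat n a d) ∧
      (Nat.card (Quot (DihSeqRel n a d)) : ℚ) = Bq 3 n ∧
      (({o : Quot (DihSeqRel n a d) |
          ∀ u : PerStat n a d, Quot.mk (DihSeqRel n a d) u = o →
            MinPeriodExact n (u : ℤ → ℝ)}.ncard : ℚ) = BLq 3 n) := by
  have hn0 : 0 < n := by omega
  refine ⟨Nagumo.radius a ^ 3 / 2, half_pos (pow_pos (Nagumo.radius_pos ha) 3), fun d hd => ?_⟩
  have hc := Nagumo.color_bijOn hn0 ha hd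
  have hinj := Nagumo.orbitColor_injective hc.injOn
  refine ⟨?_, fun u hu l => Nagumo.translate_mem_perStat hu l,
    fun u hu => Nagumo.reflect_mem_perStat hu, ?_, ?_⟩
  · rw [← Nagumo.ncard_periodic 3 hn0, ← hc.image_eq, hc.injOn.ncard_image]
  · rw [← Nagumo.ncard_orbitPeriod_dvd_eq_Bq 3 hn0, ← Nagumo.orbitColor_range hc,
      ← Set.image_univ, Set.ncard_image_of_injective _ hinj, Set.ncard_univ]
  · rw [← Nagumo.ncard_orbitPeriod_eq 3 hn0, ← Nagumo.orbitColor_image_minPeriodExact hn0 hc,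
      Set.ncard_image_of_injective _ hinj]
end

section
/- Fix $n \ge 3$ and $a \in (0,1)$. There exists $d_0 > 0$ such that for every $d \in (0, d_0)$: the set $S^{st}$ of asymptotically stable $n$-periodic stationary solutions of the lattice Nagumo equation (asymptotic stability taken with respect to the $\ell^\infty$-norm) has exactly $2^n$ elements, it is invariant under the translations $(\mathcal{T}_\ell u)_i = u_{i+\ell}$ and the reflection $(\mathcal{R} u)_i = u_{1-i}$, the number of orbits of the translation action of $\mathbb{Z}/n\mathbb{Z}$ on $S^{st}$ equals $N_2(n) = \frac{1}{n}\sum_{d' \mid n}\varphi(d')2^{n/d'}$, and the number of orbits of the dihedral action (translations and reflection) on $S^{st}$ equals $B_2(n)$. -/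
open Filter

/-- A solution (for `t ≥ 0`) of the lattice Nagumo equation, viewed as a differentiable
curve in `ℓ^∞(ℤ; ℝ)` satisfying the equation componentwise. -/
def IsLDESol (a d : ℝ) (U : ℝ → lp (fun _ : ℤ => ℝ) ⊤) : Prop :=
  ∀ t : ℝ, 0 ≤ t → ∃ U' : lp (fun _ : ℤ => ℝ) ⊤, HasDerivAt U U' t ∧
    ∀ i : ℤ, U' i = d * (U t (i - 1) - 2 * U t i + U t (i + 1)) + g a (U t i)

/-- Asymptotic stability of an equilibrium `p ∈ ℓ^∞(ℤ;ℝ)` of the lattice Nagumo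
equation, with respect to the `ℓ^∞`-norm. -/
def LDEAsympStable (a d : ℝ) (p : lp (fun _ : ℤ => ℝ) ⊤) : Prop :=
  (∀ ε > 0, ∃ δ > 0, ∀ U : ℝ → lp (fun _ : ℤ => ℝ) ⊤, IsLDESol a d U → ‖U 0 - p‖ < δ →
      ∀ t : ℝ, 0 ≤ t → ‖U t - p‖ < ε) ∧
  ∃ δ > 0, ∀ U : ℝ → lp (fun _ : ℤ => ℝ) ⊤, IsLDESol a d U → ‖U 0 - p‖ < δ →
      Tendsto U atTop (nhds p)

/-- The set of asymptotically stable `n`-periodic stationary solutions of the lattice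
Nagumo equation (asymptotic stability with respect to the `ℓ^∞`-norm). -/
noncomputable def StablePerStat (n : ℕ) (a d : ℝ) : Set (ℤ → ℝ) :=
  {u : ℤ → ℝ | (∀ i : ℤ, u (i + n) = u i) ∧
    (∀ i : ℤ, d * (u (i - 1) - 2 * u i + u (i + 1)) + g a (u i) = 0) ∧
    ∀ p : lp (fun _ : ℤ => ℝ) ⊤, (∀ i : ℤ, p i = u i) → LDEAsympStable a d p}

/-- The elementary translation relation on stable periodic solutions; the quotient
`Quot (TransRelS n a d)` identifies solutions in the same translation orbit. -/
def TransRelS (n : ℕ) (a d : ℝ) (u v : StablePerStat n a d) : Prop :=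
  ∀ i : ℤ, (v : ℤ → ℝ) i = (u : ℤ → ℝ) (i + 1)

/-- The generating relation of the dihedral action (translations and reflection) on
stable periodic solutions. -/
def DihRelS (n : ℕ) (a d : ℝ) (u v : StablePerStat n a d) : Prop :=
  (∀ i : ℤ, (v : ℤ → ℝ) i = (u : ℤ → ℝ) (i + 1)) ∨
  (∀ i : ℤ, (v : ℤ → ℝ) i = (u : ℤ → ℝ) (1 - i))

/-- Boolean functions invariant under an involution correspond to arbitrary functions on a set of
orbit representatives. -/
theorem card_involutive_invariant {X : Type*} [Fintype X] [LinearOrder X] {σ : X → X}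
    (hσ : Function.Involutive σ) :
    Nat.card {f : X → Bool // ∀ x, f (σ x) = f x} = 2 ^ Nat.card {x // x ≤ σ x} := by
  have e : {f : X → Bool // ∀ x, f (σ x) = f x} ≃ ({x // x ≤ σ x} → Bool) :=
    { toFun := fun f x => f.1 x
      invFun := fun w => ⟨fun x => if h : x ≤ σ x then w ⟨x, h⟩ else
          w ⟨σ x, by rw [hσ x]; exact (not_le.1 h).le⟩, fun x => by
        by_cases h : x ≤ σ x
        · by_cases h' : σ x ≤ x
          · have hx : σ x = x := le_antisymm h' h
            simp [hx]
          · simp [h, hσ x, h']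
        · simp [h, hσ x, (not_le.1 h).le]⟩
      left_inv := fun f => by
        ext x
        by_cases h : x ≤ σ x <;> simp [h, f.2]
      right_inv := fun w => by
        ext x
        simp [x.2] }
  rw [Nat.card_congr e, Nat.card_fun]
  simp

theorem two_mul_card_le_involutive {X : Type*} [Fintype X] [LinearOrder X] {σ : X → X}
    (hσ : Function.Involutive σ) :
    2 * Nat.card {x // x ≤ σ x} = Fintype.card X + Nat.card {x // σ x = x} := by
  classical
  have h1 : (Finset.univ.filter fun x => x ≤ σ x).card =
      (Finset.univ.filter fun x => x < σ x).card + (Finset.univ.filter fun x => σ x = x).card := by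
    rw [← Finset.card_union_of_disjoint]
    · congr 1
      ext x
      simp [le_iff_lt_or_eq, eq_comm]
    · rw [Finset.disjoint_filter]
      intro x _ h h'
      exact h.ne h'.symm
  have h2 : (Finset.univ.filter fun x => x ≤ σ x).card =
      (Finset.univ.filter fun x => σ x ≤ x).card := by
    refine Finset.card_bij (fun x _ => σ x) ?_ (fun _ _ _ _ h => hσ.injective h) ?_
    · intro x hx
      simpa [hσ x] using hx
    · intro x hx
      exact ⟨σ x, by simpa [hσ x] using hx, hσ x⟩
  have h3 : (Finset.univ.filter fun x => x < σ x).card +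
      (Finset.univ.filter fun x => σ x ≤ x).card = Fintype.card X := by
    have h := Finset.card_filter_add_card_filter_not (s := Finset.univ) (fun x : X => x < σ x)
    simpa only [not_lt, Finset.card_univ] using h
  simp only [Nat.card_eq_fintype_card, Fintype.card_subtype]
  omega

section Words

variable {n : ℕ} [NeZero n]

/-- Number of Boolean words on the cycle `ZMod n` that are invariant under a translation. -/
theorem card_translation_invariant (k : ZMod n) :
    Nat.card {w : ZMod n → Bool // ∀ x, w (x + k) = w x} = 2 ^ (n / addOrderOf k) := by
  have e : {w : ZMod n → Bool // ∀ x, w (x + k) = w x} ≃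
      ((ZMod n ⧸ AddSubgroup.zmultiples k) → Bool) :=
    { toFun := fun w => fun q => Quotient.liftOn' q w.1 (fun x y h => by
        rw [QuotientAddGroup.leftRel_apply, AddSubgroup.mem_zmultiples_iff] at h
        obtain ⟨m, hm⟩ := h
        have hp : Function.Periodic w.1 k := w.2
        have := hp.zsmul m x
        rw [hm] at this
        simpa using this.symm)
      invFun := fun v => ⟨fun x => v (x : ZMod n ⧸ AddSubgroup.zmultiples k), fun x => by
        refine congrArg v (QuotientAddGroup.eq.2 ?_)
        simp⟩
      left_inv := fun w => rfl
      right_inv := fun v => by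
        ext q
        induction q using Quotient.inductionOn'
        rfl }
  have hc := AddSubgroup.card_eq_card_quotient_mul_card_addSubgroup (AddSubgroup.zmultiples k)
  rw [Nat.card_zmod, Nat.card_zmultiples] at hc
  rw [Nat.card_congr e, Nat.card_fun, Nat.div_eq_of_eq_mul_left (addOrderOf_pos k) hc]
  simp

theorem sum_two_pow_div_addOrderOf :
    ∑ k : ZMod n, 2 ^ (n / addOrderOf k) = ∑ d ∈ n.divisors, Nat.totient d * 2 ^ (n / d) := by
  rw [← Finset.sum_fiberwise_of_maps_to (s := Finset.univ) (t := n.divisors)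
    (g := fun k : ZMod n => addOrderOf k)]
  · refine Finset.sum_congr rfl fun d hd => ?_
    rw [Finset.sum_congr rfl (g := fun _ => 2 ^ (n / d))]
    · rw [Finset.sum_const, smul_eq_mul]
      congr 1
      exact IsAddCyclic.card_addOrderOf_eq_totient (by simpa using Nat.dvd_of_mem_divisors hd)
    · intro k hk
      rw [(Finset.mem_filter.1 hk).2]
  · intro k _
    rw [Nat.mem_divisors]
    refine ⟨?_, NeZero.ne n⟩
    simpa using addOrderOf_dvd_natCard k

theorem card_reflection_invariant (c : ZMod n) :
    ∃ m, Nat.card {w : ZMod n → Bool // ∀ x, w (c - x) = w x} = 2 ^ m ∧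
      2 * m = n + Nat.card {x : ZMod n // x + x = c} := by
  let : LinearOrder (ZMod n) := LinearOrder.lift' ZMod.val (ZMod.val_injective n)
  have hσ : Function.Involutive (fun x : ZMod n => c - x) := fun x => by simp
  refine ⟨_, card_involutive_invariant hσ, ?_⟩
  rw [two_mul_card_le_involutive hσ, ZMod.card]
  congr 1
  refine Nat.card_congr (Equiv.subtypeEquivRight fun x => ?_)
  rw [sub_eq_iff_eq_add, eq_comm]

theorem card_add_self_eq_of_odd {n : ℕ} (hn : Odd n) (c : ZMod n) :
    Nat.card {x : ZMod n // x + x = c} = 1 := by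
  have hu : IsUnit ((2 : ℕ) : ZMod n) := (ZMod.isUnit_iff_coprime 2 n).2 (by simpa using hn)
  obtain ⟨u, hu⟩ := hu
  rw [Nat.card_eq_one_iff_exists]
  refine ⟨⟨(↑u⁻¹ : ZMod n) * c, ?_⟩, ?_⟩
  · rw [← two_mul]
    have : (2 : ZMod n) = u := by rw [hu]; norm_num
    rw [this, Units.mul_inv_cancel_left]
  · rintro ⟨y, hy⟩
    have : (2 : ZMod n) = u := by rw [hu]; norm_num
    ext
    simp [← hy, ← two_mul, this]

theorem card_add_self_eq_zero_of_even (hn : Even n) :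
    Nat.card {x : ZMod n // x + x = 0} = 2 := by
  obtain ⟨m, hm⟩ := hn
  have hm0 : m ≠ 0 := by rintro rfl; exact NeZero.ne n hm
  have hval : (m : ZMod n).val = m := ZMod.val_cast_of_lt (by omega)
  have hne : (m : ZMod n) ≠ 0 := fun h => hm0 (by rw [← hval, h, ZMod.val_zero])
  have : {x : ZMod n | x + x = 0} = {0, (m : ZMod n)} := by
    ext x
    simp only [Set.mem_ofPred_eq, Set.mem_insert_iff, Set.mem_singleton_iff]
    rw [add_eq_zero_iff_neg_eq, ZMod.neg_eq_self_iff]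
    refine or_congr_right ⟨fun h => ?_, fun h => ?_⟩
    · apply ZMod.val_injective n
      omega
    · rw [h, hval]
      omega
  change Nat.card {x : ZMod n | x + x = 0} = 2
  rw [this, Nat.card_coe_set_eq, Set.ncard_pair hne.symm]

/-- The fibres of doubling on `ZMod n`, `n` even, are empty or have two elements, and
half of them are empty. -/
theorem sum_card_reflection_invariant_of_even (hn : Even n) :
    2 * ∑ c : ZMod n, Nat.card {w : ZMod n → Bool // ∀ x, w (c - x) = w x} =
      n * (3 * 2 ^ (n / 2)) := by
  classical
  obtain ⟨m, hm⟩ := hn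
  have hfib : ∀ c : ZMod n, Nat.card {x : ZMod n // x + x = c} =
      if (∃ y : ZMod n, y + y = c) then 2 else 0 := by
    intro c
    split_ifs with h
    · obtain ⟨y, rfl⟩ := h
      rw [← card_add_self_eq_zero_of_even (n := n) ⟨m, hm⟩]
      refine Nat.card_congr ((Equiv.subRight y).subtypeEquiv fun x => ?_)
      simp only [Equiv.subRight_apply]
      rw [← sub_eq_zero]
      ring_nf
    · rw [Nat.card_eq_zero]
      exact Or.inl ⟨fun x => h ⟨x.1, x.2⟩⟩
  have hterm : ∀ c : ZMod n, Nat.card {w : ZMod n → Bool // ∀ x, w (c - x) = w x} =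
      2 ^ m + (if (∃ y : ZMod n, y + y = c) then 1 else 0) * 2 ^ m := by
    intro c
    obtain ⟨k, hk, hk2⟩ := card_reflection_invariant c
    rw [hk]
    rw [hfib c] at hk2
    split_ifs at hk2 ⊢
    · have : k = m + 1 := by omega
      rw [this]; ring
    · have : k = m := by omega
      rw [this]; ring
  have hcount : ∑ c : ZMod n, (if (∃ y : ZMod n, y + y = c) then 1 else 0) = m := by
    have h1 : ∑ c : ZMod n, Nat.card {x : ZMod n // x + x = c} = n := by
      have := Fintype.card_congr (Equiv.sigmaFiberEquiv fun x : ZMod n => x + x)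
      rw [Fintype.card_sigma, ZMod.card] at this
      simpa only [Nat.card_eq_fintype_card] using this
    have h2 : ∑ c : ZMod n, Nat.card {x : ZMod n // x + x = c} =
        2 * ∑ c : ZMod n, (if (∃ y : ZMod n, y + y = c) then 1 else 0) := by
      rw [Finset.mul_sum]
      refine Finset.sum_congr rfl fun c _ => ?_
      rw [hfib c]
      split_ifs <;> rfl
    omega
  have hm2 : n / 2 = m := by omega
  rw [Finset.sum_congr rfl fun c _ => hterm c, Finset.sum_add_distrib, ← Finset.sum_mul, hcount,
    Finset.sum_const, Finset.card_univ, ZMod.card, hm2, smul_eq_mul, hm]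
  ring

theorem sum_card_reflection_invariant_of_odd (hn : Odd n) :
    ∑ c : ZMod n, Nat.card {w : ZMod n → Bool // ∀ x, w (c - x) = w x} =
      n * 2 ^ ((n + 1) / 2) := by
  have hterm : ∀ c : ZMod n, Nat.card {w : ZMod n → Bool // ∀ x, w (c - x) = w x} =
      2 ^ ((n + 1) / 2) := by
    intro c
    obtain ⟨k, hk, hk2⟩ := card_reflection_invariant c
    rw [card_add_self_eq_of_odd hn] at hk2
    rw [hk]
    congr 1
    omega
  rw [Finset.sum_congr rfl fun c _ => hterm c, Finset.sum_const, Finset.card_univ, ZMod.card,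
    smul_eq_mul]

/-- Translations acting on words on the cycle `ZMod n`. -/
abbrev wordAddAction : AddAction (ZMod n) (ZMod n → Bool) where
  vadd k w := fun x => w (x + k)
  zero_vadd w := funext fun x => congrArg w (add_zero x)
  add_vadd k l w := funext fun x => congrArg w (add_assoc x k l).symm

/-- The dihedral group acting on words on the cycle `ZMod n`. -/
abbrev wordDihedralAction : MulAction (DihedralGroup n) (ZMod n → Bool) where
  smul
    | .r k, w => fun x => w (x + k)
    | .sr k, w => fun x => w (k - x)
  one_smul w := funext fun x => congrArg w (add_zero x)
  mul_smul := by
    rintro (k | k) (l | l) w <;> funext x <;> refine congrArg w ?_ <;> ring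

/-- Burnside count of the translation orbits of Boolean words on the cycle. -/
theorem card_translation_quot :
    n * Nat.card (Quot fun v w : ZMod n → Bool => ∀ x, w x = v (x + 1)) =
      ∑ d ∈ n.divisors, Nat.totient d * 2 ^ (n / d) := by
  classical
  let _ := wordAddAction (n := n)
  set r := fun v w : ZMod n → Bool => ∀ x, w x = v (x + 1)
  have hpow : ∀ (k : ℕ) (w : ZMod n → Bool),
      Quot.mk r (fun x => w (x + (k : ZMod n))) = Quot.mk r w := by
    intro k w
    induction k with
    | zero => simp
    | succ k ih =>
      rw [← ih]
      refine (Quot.sound fun x => ?_).symm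
      push_cast
      congr 1
      ring
  have e : Quot r ≃ AddAction.orbitRel.Quotient (ZMod n) (ZMod n → Bool) :=
    { toFun := Quot.lift (fun w => Quotient.mk'' w) (fun v w h => Quotient.sound' (by
        refine (AddAction.orbitRel _ _).symm ?_
        exact ⟨1, funext fun x => (h x).symm⟩))
      invFun := Quotient.lift (fun w => Quot.mk r w) (by
        rintro v w ⟨k, rfl⟩
        have := hpow k.val w
        rw [ZMod.natCast_zmod_val] at this
        exact this)
      left_inv := fun q => Quot.inductionOn q fun _ => rfl
      right_inv := fun q => Quotient.inductionOn' q fun _ => rfl }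
  have hB := AddAction.sum_card_fixedBy_eq_card_orbits_mul_card_addGroup (ZMod n) (ZMod n → Bool)
  rw [Nat.card_congr e, Nat.card_eq_fintype_card, ← sum_two_pow_div_addOrderOf, mul_comm]
  rw [ZMod.card] at hB
  rw [← hB]
  refine Finset.sum_congr rfl fun k _ => ?_
  rw [← card_translation_invariant, ← Nat.card_eq_fintype_card]
  exact Nat.card_congr (Equiv.subtypeEquivRight fun w => funext_iff)

/-- Burnside count of the dihedral orbits of Boolean words on the cycle. -/
theorem two_mul_card_dihedral_quot :
    2 * n * Nat.card (Quot fun v w : ZMod n → Bool =>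
        (∀ x, w x = v (x + 1)) ∨ ∀ x, w x = v (1 - x)) =
      ∑ d ∈ n.divisors, Nat.totient d * 2 ^ (n / d) +
        ∑ c : ZMod n, Nat.card {w : ZMod n → Bool // ∀ x, w (c - x) = w x} := by
  classical
  let _ := wordDihedralAction (n := n)
  set r := fun v w : ZMod n → Bool => (∀ x, w x = v (x + 1)) ∨ ∀ x, w x = v (1 - x)
  have hpow : ∀ (k : ℕ) (w : ZMod n → Bool),
      Quot.mk r (fun x => w (x + (k : ZMod n))) = Quot.mk r w := by
    intro k w
    induction k with
    | zero => simp
    | succ k ih =>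
      rw [← ih]
      refine (Quot.sound (r := r) (Or.inl fun x => ?_)).symm
      push_cast
      congr 1
      ring
  have hrot : ∀ (k : ZMod n) (w : ZMod n → Bool),
      Quot.mk r (fun x => w (x + k)) = Quot.mk r w := fun k w => by
    have := hpow k.val w
    rwa [ZMod.natCast_zmod_val] at this
  have hrefl : ∀ (k : ZMod n) (w : ZMod n → Bool),
      Quot.mk r (fun x => w (k - x)) = Quot.mk r w := fun k w => by
    rw [← hrot (k - 1) w]
    refine (Quot.sound (r := r) (Or.inr fun x => ?_)).symm
    congr 1
    ring
  have e : Quot r ≃ MulAction.orbitRel.Quotient (DihedralGroup n) (ZMod n → Bool) :=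
    { toFun := Quot.lift (fun w => Quotient.mk'' w) (fun v w h => Quotient.sound' (by
        refine (MulAction.orbitRel _ _).symm ?_
        rcases h with h | h
        · exact ⟨.r 1, funext fun x => (h x).symm⟩
        · exact ⟨.sr 1, funext fun x => (h x).symm⟩))
      invFun := Quotient.lift (fun w => Quot.mk r w) (by
        rintro v w ⟨k | k, rfl⟩
        · exact hrot k w
        · exact hrefl k w)
      left_inv := fun q => Quot.inductionOn q fun _ => rfl
      right_inv := fun q => Quotient.inductionOn' q fun _ => rfl }
  have hB := MulAction.sum_card_fixedBy_eq_card_orbits_mul_card_group (DihedralGroup n)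
    (ZMod n → Bool)
  rw [Nat.card_congr e, Nat.card_eq_fintype_card, ← sum_two_pow_div_addOrderOf, mul_comm]
  rw [DihedralGroup.card] at hB
  rw [← hB, ← DihedralGroup.equivSum.symm.sum_comp, Fintype.sum_sum_type]
  congr 1
  · refine Finset.sum_congr rfl fun k _ => ?_
    rw [← card_translation_invariant, ← Nat.card_eq_fintype_card]
    exact Nat.card_congr (Equiv.subtypeEquivRight fun w => funext_iff)
  · refine Finset.sum_congr rfl fun k _ => ?_
    rw [← Nat.card_eq_fintype_card]
    exact Nat.card_congr (Equiv.subtypeEquivRight fun w => funext_iff)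

theorem card_dihedral_quot :
    (Nat.card (Quot fun v w : ZMod n → Bool =>
        (∀ x, w x = v (x + 1)) ∨ ∀ x, w x = v (1 - x)) : ℚ) = Bq 2 n := by
  have h := two_mul_card_dihedral_quot (n := n)
  set N := Nat.card (Quot fun v w : ZMod n → Bool =>
        (∀ x, w x = v (x + 1)) ∨ ∀ x, w x = v (1 - x))
  have hn0 : (n : ℚ) ≠ 0 := Nat.cast_ne_zero.2 (NeZero.ne n)
  have hq := congrArg (Nat.cast : ℕ → ℚ) h
  rw [Nat.cast_add, Nat.cast_mul, Nat.cast_mul, Nat.cast_sum] at hq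
  unfold Bq Nq
  split_ifs with he
  · have h2 := congrArg (Nat.cast : ℕ → ℚ) (sum_card_reflection_invariant_of_even he)
    rw [Nat.cast_mul] at h2
    push_cast at h2 hq ⊢
    field_simp
    linarith
  · have h2 := congrArg (Nat.cast : ℕ → ℚ)
      (sum_card_reflection_invariant_of_odd (Nat.not_even_iff_odd.1 he))
    push_cast at h2 hq ⊢
    field_simp
    linarith

end Words

/-- The difference quotient of `g a`. -/
noncomputable def gSlope (a x y : ℝ) : ℝ := -(x ^ 2 + x * y + y ^ 2) + (1 + a) * (x + y) - a

theorem g_sub_g (a x y : ℝ) : g a x - g a y = gSlope a x y * (x - y) := by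
  unfold g gSlope
  ring

theorem neg_le_gSlope {a x y : ℝ} (ha : a ∈ Set.Ioo (0 : ℝ) 1) (hx : x ∈ Set.Icc (-1 : ℝ) 2)
    (hy : y ∈ Set.Icc (-1 : ℝ) 2) : -20 ≤ gSlope a x y := by
  obtain ⟨ha0, ha1⟩ := ha
  obtain ⟨hx0, hx1⟩ := hx
  obtain ⟨hy0, hy1⟩ := hy
  unfold gSlope
  nlinarith [mul_nonneg (sub_nonneg.2 hx1) (by linarith : 0 ≤ x + 1),
    mul_nonneg (sub_nonneg.2 hy1) (by linarith : 0 ≤ y + 1), sq_nonneg (x - y),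
    mul_nonneg ha0.le (by linarith : 0 ≤ x + 1), mul_nonneg ha0.le (by linarith : 0 ≤ y + 1)]

theorem abs_gSlope_le {a x y : ℝ} (ha : a ∈ Set.Ioo (0 : ℝ) 1) (hx : x ∈ Set.Icc (0 : ℝ) 1)
    (hy : y ∈ Set.Icc (0 : ℝ) 1) : |gSlope a x y| ≤ 4 := by
  obtain ⟨ha0, ha1⟩ := ha
  obtain ⟨hx0, hx1⟩ := hx
  obtain ⟨hy0, hy1⟩ := hy
  unfold gSlope
  rw [abs_le]
  constructor <;>
    nlinarith [mul_nonneg hx0 hy0, mul_nonneg (sub_nonneg.2 hx1) (sub_nonneg.2 hy1),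
      mul_nonneg ha0.le hx0, mul_nonneg ha0.le hy0, sq_nonneg x, sq_nonneg y,
      mul_nonneg (sub_nonneg.2 hx1) hx0, mul_nonneg (sub_nonneg.2 hy1) hy0,
      mul_nonneg (sub_nonneg.2 ha1.le) hx0, mul_nonneg (sub_nonneg.2 ha1.le) hy0]

theorem abs_g_le_one {a x : ℝ} (ha : a ∈ Set.Ioo (0 : ℝ) 1) (hx : x ∈ Set.Icc (0 : ℝ) 1) :
    |g a x| ≤ 1 := by
  obtain ⟨ha0, ha1⟩ := ha
  obtain ⟨hx0, hx1⟩ := hx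
  unfold g
  rw [abs_mul, abs_mul]
  have h1 : |x| ≤ 1 := abs_le.2 ⟨by linarith, by linarith⟩
  have h2 : |1 - x| ≤ 1 := abs_le.2 ⟨by linarith, by linarith⟩
  have h3 : |x - a| ≤ 1 := abs_le.2 ⟨by linarith, by linarith⟩
  exact mul_le_one₀ (mul_le_one₀ h1 (abs_nonneg _) h2) (abs_nonneg _) h3

/-- The smallness regime: `r` is the radius of the neighbourhoods of the zeros `0`, `a`, `1`
of the nonlinearity in which stationary solutions are localized. -/
structure SmallCoupling (a d r : ℝ) : Prop where
  r_pos : 0 < r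
  le_a : 16 * r ≤ a
  le_one_sub : 16 * r ≤ 1 - a
  d_pos : 0 < d
  d_lt : 2 * d < r ^ 3

namespace SmallCoupling

variable {a d r : ℝ}

theorem mem_Ioo (h : SmallCoupling a d r) : a ∈ Set.Ioo (0 : ℝ) 1 := by
  obtain ⟨h1, h2, h3, h4, h5⟩ := h
  constructor <;> linarith

theorem r_le (h : SmallCoupling a d r) : 32 * r ≤ 1 := by
  obtain ⟨h1, h2, h3, h4, h5⟩ := h
  linarith

theorem cube_le (h : SmallCoupling a d r) : r ^ 3 ≤ r / 4 := by
  have h1 := h.r_pos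
  have h2 := h.r_le
  nlinarith [mul_pos h1 h1]

theorem gSlope_le_of_abs_le (h : SmallCoupling a d r) {x y : ℝ} (hx : |x| ≤ 2 * r)
    (hy : |y| ≤ 2 * r) : gSlope a x y ≤ -r := by
  obtain ⟨h1, h2, h3, h4, h5⟩ := h
  rw [abs_le] at hx hy
  unfold gSlope
  nlinarith [sq_nonneg (x + y), sq_nonneg x, sq_nonneg y]

theorem gSlope_le_of_abs_sub_one_le (h : SmallCoupling a d r) {x y : ℝ} (hx : |x - 1| ≤ 2 * r)
    (hy : |y - 1| ≤ 2 * r) : gSlope a x y ≤ -r := by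
  obtain ⟨h1, h2, h3, h4, h5⟩ := h
  rw [abs_le] at hx hy
  unfold gSlope
  nlinarith [sq_nonneg (x + y - 2), sq_nonneg (x - 1), sq_nonneg (y - 1)]

theorem eight_mul_le (h : SmallCoupling a d r) : 8 * r ≤ a * (1 - a) := by
  obtain ⟨h1, h2, h3, h4, h5⟩ := h
  nlinarith [mul_nonneg (sub_nonneg.2 h2) (sub_nonneg.2 h3)]

theorem near_root_of_abs_g_le (h : SmallCoupling a d r) {x : ℝ} (hx : x ∈ Set.Icc (0 : ℝ) 1)
    (hg : |g a x| ≤ 2 * d) : x ≤ r ∨ |x - a| ≤ r ∨ 1 - r ≤ x := by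
  by_contra! hcon
  obtain ⟨h1, h2, h3⟩ := hcon
  have hr := h.r_pos
  have hlt := h.d_lt
  have : r ^ 3 ≤ |g a x| := by
    unfold g
    rw [abs_mul, abs_mul, abs_of_nonneg hx.1, abs_of_nonneg (sub_nonneg.2 hx.2)]
    calc r ^ 3 = r * r * r := by ring
      _ ≤ x * (1 - x) * |x - a| := by
        have : r ≤ 1 - x := by linarith
        have h0 := hx.1
        have h0' : 0 ≤ x * (1 - x) := mul_nonneg h0 (by linarith)
        gcongr
  linarith

end SmallCoupling

section Cycle

variable {n : ℕ}

/-- The vector field of the equation on the cycle `ZMod n`. -/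
noncomputable def cycField (a d : ℝ) (x : ZMod n → ℝ) (i : ZMod n) : ℝ :=
  d * (x (i - 1) - 2 * x i + x (i + 1)) + g a (x i)

theorem cycField_sub (a d : ℝ) (x y : ZMod n → ℝ) (i : ZMod n) :
    cycField a d x i - cycField a d y i =
      d * ((x (i - 1) - y (i - 1)) - 2 * (x i - y i) + (x (i + 1) - y (i + 1))) +
        gSlope a (x i) (y i) * (x i - y i) := by
  rw [← g_sub_g]
  unfold cycField
  ring

/-- Stationary solutions on the cycle take values in `[0, 1]`. -/
theorem mem_Icc_of_stationary [NeZero n] {a d : ℝ} (ha : a ∈ Set.Ioo (0 : ℝ) 1) (hd : 0 < d)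
    {x : ZMod n → ℝ} (hx : ∀ i, cycField a d x i = 0) (i : ZMod n) : x i ∈ Set.Icc (0 : ℝ) 1 := by
  obtain ⟨ha0, ha1⟩ := ha
  constructor
  · obtain ⟨j, hj⟩ := Finite.exists_min x
    refine le_trans ?_ (hj i)
    by_contra! hneg
    have h := hx j
    unfold cycField g at h
    have h1 : 0 ≤ d * (x (j - 1) - 2 * x j + x (j + 1)) :=
      mul_nonneg hd.le (by linarith [hj (j - 1), hj (j + 1)])
    have h2 : 0 < x j * (1 - x j) * (x j - a) :=
      mul_pos_of_neg_of_neg (mul_neg_of_neg_of_pos hneg (by linarith)) (by linarith)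
    linarith
  · obtain ⟨j, hj⟩ := Finite.exists_max x
    refine (hj i).trans ?_
    by_contra! hneg
    have h := hx j
    unfold cycField g at h
    have h1 : d * (x (j - 1) - 2 * x j + x (j + 1)) ≤ 0 :=
      mul_nonpos_of_nonneg_of_nonpos hd.le (by linarith [hj (j - 1), hj (j + 1)])
    have h2 : x j * (1 - x j) * (x j - a) < 0 :=
      mul_neg_of_neg_of_pos (mul_neg_of_pos_of_neg (by linarith) (by linarith)) (by linarith)
    linarith

/-- The neighbourhoods in `[0, 1]` of the stable zeros `0` (for `false`) and `1` (for `true`). -/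
def well (r : ℝ) (b : Bool) : Set ℝ := if b then Set.Icc (1 - r) 1 else Set.Icc 0 r

theorem isClosed_well (r : ℝ) (b : Bool) : IsClosed (well r b) := by
  cases b <;> simp [well, isClosed_Icc]

namespace SmallCoupling

variable {a d r : ℝ}

theorem well_subset (h : SmallCoupling a d r) (b : Bool) : well r b ⊆ Set.Icc 0 1 := by
  have h1 := h.r_pos
  have h2 := h.r_le
  cases b
  · exact Set.Icc_subset_Icc le_rfl (by linarith)
  · exact Set.Icc_subset_Icc (by linarith) le_rfl

theorem gSlope_le_of_mem_well (h : SmallCoupling a d r) {b : Bool} {x y : ℝ} (hx : x ∈ well r b)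
    (hy : y ∈ well r b) : gSlope a x y ≤ -r := by
  have h1 := h.r_pos
  cases b <;> simp only [well, Bool.false_eq_true, if_true, if_false, Set.mem_Icc] at hx hy
  · exact h.gSlope_le_of_abs_le (abs_le.2 ⟨by linarith, by linarith⟩)
      (abs_le.2 ⟨by linarith, by linarith⟩)
  · exact h.gSlope_le_of_abs_sub_one_le (abs_le.2 ⟨by linarith, by linarith⟩)
      (abs_le.2 ⟨by linarith, by linarith⟩)

theorem d_lt_one (h : SmallCoupling a d r) : d < 1 := by
  linarith [h.r_le, h.r_pos, h.cube_le, h.d_lt]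

/-- One explicit Euler step preserves the boxes of wells. -/
theorem euler_mem_well (h : SmallCoupling a d r) {w : ZMod n → Bool} {x : ZMod n → ℝ}
    (hx : ∀ i, x i ∈ well r (w i)) (i : ZMod n) :
    x i + 1 / 10 * cycField a d x i ∈ well r (w i) := by
  have hI : ∀ j, x j ∈ Set.Icc (0 : ℝ) 1 := fun j => h.well_subset _ (hx j)
  have hrp := h.r_pos
  have hr1 := h.r_le
  have hd0 := h.d_pos
  have hd1 := h.d_lt_one
  have hdr := h.d_lt
  have hra := h.le_a
  have hra' := h.le_one_sub
  obtain ⟨hl0, hl1⟩ := hI (i - 1)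
  obtain ⟨hr0, hr1'⟩ := hI (i + 1)
  have hi := hx i
  have key : ∀ y ∈ Set.Icc (0 : ℝ) 1, x i + 1 / 10 * cycField a d x i =
      y + (x i - y) * (1 - d / 5 + gSlope a (x i) y / 10) +
        1 / 10 * (d * (x (i - 1) + x (i + 1) - 2 * y) + g a y) := by
    intro y _
    have := g_sub_g a (x i) y
    unfold cycField
    linear_combination 1 / 10 * this
  have hpos : ∀ y ∈ Set.Icc (0 : ℝ) 1, 0 ≤ 1 - d / 5 + gSlope a (x i) y / 10 := fun y hy => by
    have := (abs_le.1 (abs_gSlope_le h.mem_Ioo (hI i) hy)).1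
    linarith
  have hcube : r ^ 3 ≤ r * (1 - r) * (a - r) := by
    have h1 : r ≤ 1 - r := by linarith
    have h2 : r ≤ a - r := by linarith
    calc r ^ 3 = r * r * r := by ring
      _ ≤ r * (1 - r) * (a - r) := by
        have h0 : 0 ≤ r * (1 - r) := mul_nonneg hrp.le (by linarith)
        gcongr
  have hcube' : r ^ 3 ≤ (1 - r) * r * (1 - r - a) := by
    have h1 : r ≤ 1 - r := by linarith
    have h2 : r ≤ 1 - r - a := by linarith
    calc r ^ 3 = r * r * r := by ring
      _ ≤ (1 - r) * r * (1 - r - a) := by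
        have h0 : 0 ≤ (1 - r) * r := mul_nonneg (by linarith) hrp.le
        gcongr
  cases hw : w i <;> rw [hw] at hi <;>
    simp only [well, Bool.false_eq_true, if_true, if_false, Set.mem_Icc] at hi ⊢
  · constructor
    · rw [key 0 (by simp)]
      have h1 := mul_nonneg (sub_nonneg.2 hi.1) (hpos 0 (by simp))
      have h2 : 0 ≤ d * (x (i - 1) + x (i + 1) - 2 * 0) := mul_nonneg hd0.le (by linarith)
      have h3 : g a 0 = 0 := by simp [g]
      linarith
    · have hr : r ∈ Set.Icc (0 : ℝ) 1 := ⟨hrp.le, by linarith⟩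
      rw [key r hr]
      have h1 := mul_nonneg (sub_nonneg.2 hi.2) (hpos r hr)
      have h2 : d * (x (i - 1) + x (i + 1) - 2 * r) ≤ d * 2 :=
        mul_le_mul_of_nonneg_left (by linarith) hd0.le
      have h3 : g a r = -(r * (1 - r) * (a - r)) := by unfold g; ring
      linarith
  · constructor
    · have hr : 1 - r ∈ Set.Icc (0 : ℝ) 1 := ⟨by linarith, by linarith⟩
      rw [key (1 - r) hr]
      have h1 := mul_nonneg (sub_nonneg.2 hi.1) (hpos (1 - r) hr)
      have h2 : d * (-2) ≤ d * (x (i - 1) + x (i + 1) - 2 * (1 - r)) :=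
        mul_le_mul_of_nonneg_left (by linarith) hd0.le
      have h3 : g a (1 - r) = (1 - r) * r * (1 - r - a) := by unfold g; ring
      linarith
    · rw [key 1 (by simp)]
      have h1 := mul_nonneg (sub_nonneg.2 hi.2) (hpos 1 (by simp))
      have h2 : d * (x (i - 1) + x (i + 1) - 2 * 1) ≤ 0 :=
        mul_nonpos_of_nonneg_of_nonpos hd0.le (by linarith)
      have h3 : g a 1 = 0 := by simp [g]
      linarith

/-- One explicit Euler step contracts the sup-distance inside a box of wells. -/
theorem euler_dist_le [NeZero n] (h : SmallCoupling a d r) {w : ZMod n → Bool} {x y : ZMod n → ℝ}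
    (hx : ∀ i, x i ∈ well r (w i)) (hy : ∀ i, y i ∈ well r (w i)) :
    dist (fun i => x i + 1 / 10 * cycField a d x i) (fun i => y i + 1 / 10 * cycField a d y i) ≤
      (1 - r / 10) * dist x y := by
  have hrp := h.r_pos
  have hr1 := h.r_le
  have hd0 := h.d_pos
  have hd1 := h.d_lt_one
  refine (dist_pi_le_iff (mul_nonneg (by linarith) dist_nonneg)).2 fun i => ?_
  have hb : ∀ j, |x j - y j| ≤ dist x y := fun j => by
    rw [← Real.dist_eq]
    exact dist_le_pi_dist x y j
  have hs := h.gSlope_le_of_mem_well (hx i) (hy i)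
  have hs' := (abs_le.1 (abs_gSlope_le h.mem_Ioo (h.well_subset _ (hx i))
    (h.well_subset _ (hy i)))).1
  set s := gSlope a (x i) (y i)
  have e : x i + 1 / 10 * cycField a d x i - (y i + 1 / 10 * cycField a d y i) =
      (1 - d / 5 + s / 10) * (x i - y i) + d / 10 * (x (i - 1) - y (i - 1)) +
        d / 10 * (x (i + 1) - y (i + 1)) := by
    have := cycField_sub a d x y i
    linear_combination 1 / 10 * this
  have hcoef : 0 ≤ 1 - d / 5 + s / 10 := by linarith
  rw [Real.dist_eq, e]
  have hD : 0 ≤ dist x y := dist_nonneg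
  calc _ ≤ |(1 - d / 5 + s / 10) * (x i - y i)| + |d / 10 * (x (i - 1) - y (i - 1))| +
        |d / 10 * (x (i + 1) - y (i + 1))| := abs_add_three _ _ _
    _ = (1 - d / 5 + s / 10) * |x i - y i| + d / 10 * |x (i - 1) - y (i - 1)| +
        d / 10 * |x (i + 1) - y (i + 1)| := by
      rw [abs_mul, abs_mul, abs_mul, abs_of_nonneg hcoef, abs_of_nonneg (by linarith : 0 ≤ d / 10)]
    _ ≤ (1 - d / 5 + s / 10) * dist x y + d / 10 * dist x y + d / 10 * dist x y := by
      gcongr <;> exact hb _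
    _ = (1 + s / 10) * dist x y := by ring
    _ ≤ _ := by gcongr; linarith

/-- Each word carries exactly one stationary solution in its box of wells. -/
theorem existsUnique_stationary [NeZero n] (h : SmallCoupling a d r) (w : ZMod n → Bool) :
    ∃! x : ZMod n → ℝ, (∀ i, x i ∈ well r (w i)) ∧ ∀ i, cycField a d x i = 0 := by
  have hrp := h.r_pos
  have hr1 := h.r_le
  set T : (ZMod n → ℝ) → ZMod n → ℝ := fun x i => x i + 1 / 10 * cycField a d x i with hT
  set s : Set (ZMod n → ℝ) := {x | ∀ i, x i ∈ well r (w i)} with hs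
  have hsc : IsComplete s := by
    refine IsClosed.isComplete ?_
    have : s = Set.pi Set.univ fun i => well r (w i) := by
      ext x
      simp [hs, Set.mem_pi]
    rw [this]
    exact isClosed_set_pi fun i _ => isClosed_well _ _
  have hmaps : Set.MapsTo T s s := fun x hx i => h.euler_mem_well hx i
  have hcon : ContractingWith (Real.toNNReal (1 - r / 10)) (hmaps.restrict T s s) := by
    refine ⟨?_, LipschitzWith.of_dist_le_mul fun x y => ?_⟩
    · rw [Real.toNNReal_lt_one]
      linarith
    · rw [Real.coe_toNNReal _ (by linarith)]
      exact h.euler_dist_le x.2 y.2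
  have hne : (fun i => if w i then (1 : ℝ) else 0) ∈ s := by
    intro i
    cases hw : w i <;> simp [well, hw, hrp.le]
  obtain ⟨x, hxs, hfix, -⟩ := hcon.exists_fixedPoint' hsc hmaps hne (edist_ne_top _ _)
  refine ⟨x, ⟨hxs, fun i => ?_⟩, ?_⟩
  · have := congrFun hfix i
    simp only [hT] at this
    linarith
  · rintro y ⟨hys, hy0⟩
    have hyfix : T y = y := funext fun i => by simp [hT, hy0 i]
    have hd := h.euler_dist_le hys hxs
    change dist (T y) (T x) ≤ _ at hd
    rw [hyfix, hfix] at hd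
    have : dist y x ≤ 0 := by nlinarith [dist_nonneg (x := y) (y := x)]
    exact dist_le_zero.1 this

end SmallCoupling

end Cycle

/-- Near a stationary solution at which the difference quotients of the nonlinearity are
negative, one linearized time step contracts the distance to it. -/
theorem norm_sub_add_smul_le {a d c δ M h : ℝ} {p u u' : lp (fun _ : ℤ => ℝ) ⊤} (hd : 0 ≤ d)
    (hstat : ∀ i : ℤ, d * (p (i - 1) - 2 * p i + p (i + 1)) + g a (p i) = 0)
    (hup : ∀ (i : ℤ) (y : ℝ), |y - p i| ≤ δ → gSlope a y (p i) ≤ -c)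
    (hlo : ∀ (i : ℤ) (y : ℝ), |y - p i| ≤ δ → -M ≤ gSlope a y (p i))
    (hu : ‖u - p‖ ≤ δ)
    (hu' : ∀ i : ℤ, u' i = d * (u (i - 1) - 2 * u i + u (i + 1)) + g a (u i))
    (hh : 0 ≤ h) (hhM : h * (2 * d + M) ≤ 1) :
    ‖(u - p) + h • u'‖ ≤ (1 - h * c) * ‖u - p‖ := by
  have hb : ∀ i, |u i - p i| ≤ ‖u - p‖ := fun i =>
    lp.norm_apply_le_norm ENNReal.top_ne_zero (u - p) i
  have hcoef : ∀ i, 0 ≤ 1 - 2 * (h * d) + h * gSlope a (u i) (p i) := fun i => by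
    have := mul_le_mul_of_nonneg_left (hlo i (u i) ((hb i).trans hu)) hh
    linarith
  have hN := norm_nonneg (u - p)
  have hstep : ∀ i, 0 ≤ 1 + h * gSlope a (u i) (p i) ∧
      1 + h * gSlope a (u i) (p i) ≤ 1 - h * c := fun i => by
    have h1 := mul_le_mul_of_nonneg_left (hup i (u i) ((hb i).trans hu)) hh
    have h2 := hcoef i
    have h3 := mul_nonneg hh hd
    constructor <;> linarith
  refine lp.norm_le_of_forall_le
    (mul_nonneg ((hstep 0).1.trans (hstep 0).2) hN) fun i => ?_
  have e : ((u - p) + h • u' : lp (fun _ : ℤ => ℝ) ⊤) i =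
      (1 - 2 * (h * d) + h * gSlope a (u i) (p i)) * (u i - p i) +
        h * d * (u (i - 1) - p (i - 1)) + h * d * (u (i + 1) - p (i + 1)) := by
    have h1 := g_sub_g a (u i) (p i)
    have h2 := hstat i
    change u i - p i + h * u' i = _
    rw [hu' i]
    linear_combination h * h1 + h * h2
  rw [Real.norm_eq_abs, e]
  have hhd := mul_nonneg hh hd
  calc _ ≤ |(1 - 2 * (h * d) + h * gSlope a (u i) (p i)) * (u i - p i)| +
        |h * d * (u (i - 1) - p (i - 1))| + |h * d * (u (i + 1) - p (i + 1))| :=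
        abs_add_three _ _ _
    _ = (1 - 2 * (h * d) + h * gSlope a (u i) (p i)) * |u i - p i| +
        h * d * |u (i - 1) - p (i - 1)| + h * d * |u (i + 1) - p (i + 1)| := by
      rw [abs_mul (_ + _), abs_mul (h * d), abs_mul (h * d), abs_of_nonneg (hcoef i),
        abs_of_nonneg hhd]
    _ ≤ (1 - 2 * (h * d) + h * gSlope a (u i) (p i)) * ‖u - p‖ +
        h * d * ‖u - p‖ + h * d * ‖u - p‖ := by
      have := hcoef i
      gcongr <;> exact hb _
    _ = (1 + h * gSlope a (u i) (p i)) * ‖u - p‖ := by ring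
    _ ≤ _ := mul_le_mul_of_nonneg_right (hstep i).2 hN

/-- Exponential decay towards a stationary solution with negative difference quotients. -/
theorem norm_sub_le_exp {a d c δ M η : ℝ} {p : lp (fun _ : ℤ => ℝ) ⊤} (hd : 0 < d) (hc : 0 < c)
    (hstat : ∀ i : ℤ, d * (p (i - 1) - 2 * p i + p (i + 1)) + g a (p i) = 0)
    (hup : ∀ (i : ℤ) (y : ℝ), |y - p i| ≤ δ → gSlope a y (p i) ≤ -c)
    (hlo : ∀ (i : ℤ) (y : ℝ), |y - p i| ≤ δ → -M ≤ gSlope a y (p i))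
    (hη : 0 < η) (hηδ : η ≤ δ) {U : ℝ → lp (fun _ : ℤ => ℝ) ⊤} (hU : IsLDESol a d U)
    (h0 : ‖U 0 - p‖ ≤ η) {t : ℝ} (ht : 0 ≤ t) :
    ‖U t - p‖ ≤ η * Real.exp (-(c / 2) * t) := by
  classical
  choose! U' hderiv hU' using hU
  have hMpos : 0 < 2 * d + M := by
    have h1 := hup 0 (p 0) (by simpa using hη.le.trans hηδ)
    have h2 := hlo 0 (p 0) (by simpa using hη.le.trans hηδ)
    linarith
  have hcont : ContinuousOn (fun s => ‖U s - p‖) (Set.Icc 0 t) := fun s hs =>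
    ((hderiv s hs.1).continuousAt.sub continuousAt_const).norm.continuousWithinAt
  refine image_le_of_liminf_slope_right_lt_deriv_boundary
    (f' := fun s => if ‖U s - p‖ ≤ δ then -c * ‖U s - p‖ else ‖U' s‖)
    (B := fun s => η * Real.exp (-(c / 2) * s))
    (B' := fun s => η * (Real.exp (-(c / 2) * s) * (-(c / 2)))) hcont ?_ (by simpa using h0) ?_ ?_
    (Set.right_mem_Icc.2 ht)
  · intro s hs ρ hρ
    split_ifs at hρ with hsδ
    · set ε := ρ + c * ‖U s - p‖ with hε
      have hεpos : 0 < ε / 2 := by linarith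
      have h1 : ∀ᶠ z in nhds s, ‖U z - U s - (z - s) • U' s‖ ≤ ε / 2 * ‖z - s‖ :=
        (hasDerivAt_iff_isLittleO.1 (hderiv s hs.1)).def hεpos
      have h2 : ∀ᶠ z in nhdsWithin s (Set.Ioi s), z ∈ Set.Ioo s (s + 1 / (2 * d + M)) :=
        Ioo_mem_nhdsGT (by linarith [one_div_pos.2 hMpos])
      refine Eventually.frequently ?_
      filter_upwards [nhdsWithin_le_nhds h1, h2] with z hz1 hz2
      have hzs : 0 < z - s := sub_pos.2 hz2.1
      rw [slope_def_field, div_lt_iff₀ hzs]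
      have h3 := norm_sub_add_smul_le hd.le hstat hup hlo hsδ (hU' s hs.1) hzs.le (by
        have := hz2.2
        rw [← le_div_iff₀ hMpos]
        linarith)
      rw [Real.norm_eq_abs, abs_of_pos hzs] at hz1
      have h4 : ‖U z - p‖ ≤ ‖(U s - p) + (z - s) • U' s‖ + ‖U z - U s - (z - s) • U' s‖ := by
        refine le_trans (le_of_eq ?_) (norm_add_le _ _)
        congr 1
        abel
      have h5 : 0 < ε / 2 * (z - s) := mul_pos hεpos hzs
      have h6 : ε * (z - s) = ρ * (z - s) + c * ‖U s - p‖ * (z - s) := by rw [hε]; ring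
      linarith
    · have h := (((hderiv s hs.1).sub_const p).hasDerivWithinAt
        (s := Set.Ici s)).liminf_right_slope_norm_le hρ
      refine h.mono fun z hz => ?_
      rw [slope_def_field, div_eq_inv_mul]
      exact hz
  · intro s
    have h1 : HasDerivAt (fun s : ℝ => -(c / 2) * s) (-(c / 2)) s := by
      simpa using (hasDerivAt_id s).const_mul (-(c / 2))
    exact h1.exp.const_mul η
  · intro s hs heq
    have he : Real.exp (-(c / 2) * s) ≤ 1 := Real.exp_le_one_iff.2 (by nlinarith [hs.1])
    have hle : ‖U s - p‖ ≤ δ := by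
      rw [heq]
      exact (mul_le_of_le_one_right hη.le he).trans hηδ
    simp only [hle, if_true]
    rw [heq]
    have := mul_pos (mul_pos hη (Real.exp_pos (-(c / 2) * s))) hc
    linarith

theorem asympStable_of_gSlope_le {a d c δ M : ℝ} {p : lp (fun _ : ℤ => ℝ) ⊤} (hd : 0 < d)
    (hc : 0 < c) (hδ : 0 < δ)
    (hstat : ∀ i : ℤ, d * (p (i - 1) - 2 * p i + p (i + 1)) + g a (p i) = 0)
    (hup : ∀ (i : ℤ) (y : ℝ), |y - p i| ≤ δ → gSlope a y (p i) ≤ -c)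
    (hlo : ∀ (i : ℤ) (y : ℝ), |y - p i| ≤ δ → -M ≤ gSlope a y (p i)) :
    LDEAsympStable a d p := by
  refine ⟨fun ε hε => ?_, δ, hδ, fun U hU h0 => ?_⟩
  · have hη : 0 < min δ (ε / 2) := lt_min hδ (by linarith)
    refine ⟨_, hη, fun U hU h0 t ht => ?_⟩
    have h1 := norm_sub_le_exp hd hc hstat hup hlo hη (min_le_left _ _) hU h0.le ht
    have he : Real.exp (-(c / 2) * t) ≤ 1 := Real.exp_le_one_iff.2 (by nlinarith)
    have h2 := mul_le_of_le_one_right hη.le he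
    have h3 : min δ (ε / 2) ≤ ε / 2 := min_le_right _ _
    linarith
  · rw [tendsto_iff_norm_sub_tendsto_zero]
    refine squeeze_zero' (Eventually.of_forall fun t => norm_nonneg _)
      (g := fun t => δ * Real.exp (-(c / 2) * t)) ?_ ?_
    · filter_upwards [eventually_ge_atTop 0] with t ht
      exact norm_sub_le_exp hd hc hstat hup hlo hδ le_rfl hU h0.le ht
    · have h1 : Tendsto (fun t : ℝ => -(c / 2) * t) atTop atBot :=
        tendsto_id.const_mul_atTop_of_neg (by linarith)
      simpa using (Real.tendsto_exp_atBot.comp h1).const_mul δ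

/-- A bounded, globally Lipschitz vector field has global integral curves. -/
theorem exists_global_integralCurve {E : Type*} [NormedAddCommGroup E] [NormedSpace ℝ E]
    [CompleteSpace E] {F : E → E} {K L : NNReal} (hF : LipschitzWith K F) (hL : ∀ x, ‖F x‖ ≤ L)
    (x₀ : E) : ∃ γ : ℝ → E, γ 0 = x₀ ∧ ∀ t, HasDerivAt γ (F (γ t)) t := by
  have hex : ∀ N : ℕ, ∃ γ : ℝ → E, γ 0 = x₀ ∧
      ∀ t ∈ Set.Ioo (-(N : ℝ)) N, HasDerivAt γ (F (γ t)) t := by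
    intro N
    have hN : (0 : ℝ) ∈ Set.Icc (-(N : ℝ)) N := by simp
    have hP : IsPicardLindelof (fun _ => F) (⟨0, hN⟩ : Set.Icc (-(N : ℝ)) N) x₀ (L * N) 0 L K :=
      IsPicardLindelof.of_time_independent (fun x _ => hL x) hF.lipschitzOnWith (by simp)
    obtain ⟨γ, h0, hγ⟩ := hP.exists_eq_forall_mem_Icc_hasDerivWithinAt₀
    exact ⟨γ, h0, fun t ht => (hγ t (Set.Ioo_subset_Icc_self ht)).hasDerivAt
      (Icc_mem_nhds ht.1 ht.2)⟩
  choose γ h0 hγ using hex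
  have hagree : ∀ {M N : ℕ}, 0 < M → M ≤ N → Set.EqOn (γ N) (γ M) (Set.Ioo (-(M : ℝ)) M) := by
    intro M N hM hMN
    have hM' : (0 : ℝ) < M := by exact_mod_cast hM
    have hMN' : (M : ℝ) ≤ N := by exact_mod_cast hMN
    refine ODE_solution_unique_of_mem_Ioo (v := fun _ => F) (s := fun _ => Set.univ) (t₀ := 0)
      (K := K) (fun _ _ => hF.lipschitzOnWith) (by simp [hM']) (fun t ht => ⟨hγ N t ?_, trivial⟩)
      (fun t ht => ⟨hγ M t ht, trivial⟩) (by rw [h0, h0])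
    exact ⟨by linarith [ht.1], by linarith [ht.2]⟩
  refine ⟨fun t => γ (⌈|t|⌉₊ + 1) t, h0 _, fun t => ?_⟩
  set N := ⌈|t|⌉₊ + 2 with hN
  have heq : ∀ s : ℝ, |s| < N → γ (⌈|s|⌉₊ + 1) s = γ N s := by
    intro s hs
    have h1 : ⌈|s|⌉₊ ≤ N := Nat.ceil_le.2 hs.le
    have h2 : |s| < ((⌈|s|⌉₊ + 1 : ℕ) : ℝ) := by
      push_cast
      linarith [Nat.le_ceil |s|]
    rcases Nat.le_total (⌈|s|⌉₊ + 1) N with h | h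
    · exact (hagree (Nat.succ_pos _) h (abs_lt.1 h2)).symm
    · exact hagree (by omega) h (abs_lt.1 hs)
  have ht : |t| < N := by
    rw [hN]
    push_cast
    linarith [Nat.le_ceil |t|]
  have hev : (fun s => γ (⌈|s|⌉₊ + 1) s) =ᶠ[nhds t] γ N := by
    filter_upwards [(continuous_abs.tendsto t).eventually_lt_const ht] with s hs using heq s hs
  simp only [heq t ht]
  exact (hγ N t (abs_lt.1 ht)).congr_of_eventuallyEq hev

section Classification

variable {n : ℕ} [NeZero n]

/-- The vector field on the cycle composed with the projection onto `[0, 1]` in every coordinate. -/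
noncomputable def clampedField (a d : ℝ) (x : ZMod n → ℝ) : ZMod n → ℝ :=
  cycField a d fun i => max 0 (min 1 (x i))

theorem clamp_mem_Icc (x : ℝ) : max 0 (min 1 x) ∈ Set.Icc (0 : ℝ) 1 :=
  ⟨le_max_left _ _, max_le zero_le_one (min_le_left _ _)⟩

theorem clamp_of_mem_Icc {x : ℝ} (hx : x ∈ Set.Icc (0 : ℝ) 1) : max 0 (min 1 x) = x := by
  rw [min_eq_right hx.2, max_eq_right hx.1]

theorem abs_clamp_sub_clamp_le (x y : ℝ) :
    |max 0 (min 1 x) - max 0 (min 1 y)| ≤ |x - y| := by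
  have h₁ := abs_max_sub_max_le_max 0 (min 1 x) 0 (min 1 y)
  have h₂ := abs_min_sub_min_le_max 1 x 1 y
  simp only [sub_self, abs_zero, abs_nonneg, sup_of_le_right] at h₁ h₂
  exact h₁.trans h₂

theorem lipschitzWith_clampedField {a d : ℝ} (ha : a ∈ Set.Ioo (0 : ℝ) 1) (hd : 0 < d) :
    LipschitzWith (Real.toNNReal (4 * d + 4)) (clampedField (n := n) a d) := by
  refine LipschitzWith.of_dist_le_mul fun x y => ?_
  rw [Real.coe_toNNReal _ (by linarith)]
  refine (dist_pi_le_iff (mul_nonneg (by linarith) dist_nonneg)).2 fun i => ?_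
  set X : ZMod n → ℝ := fun i => max 0 (min 1 (x i))
  set Y : ZMod n → ℝ := fun i => max 0 (min 1 (y i))
  have hb : ∀ j, |X j - Y j| ≤ dist x y := fun j =>
    (abs_clamp_sub_clamp_le _ _).trans (by
      rw [← Real.dist_eq]
      exact dist_le_pi_dist x y j)
  have hs := abs_gSlope_le ha (clamp_mem_Icc (x i)) (clamp_mem_Icc (y i))
  change |gSlope a (X i) (Y i)| ≤ 4 at hs
  have hD : 0 ≤ dist x y := dist_nonneg
  rw [Real.dist_eq]
  change |cycField a d X i - cycField a d Y i| ≤ _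
  rw [cycField_sub]
  calc _ ≤ d * |X (i - 1) - Y (i - 1) - 2 * (X i - Y i) + (X (i + 1) - Y (i + 1))| +
        |gSlope a (X i) (Y i)| * |X i - Y i| := by
        refine (abs_add_le _ _).trans ?_
        rw [abs_mul, abs_mul, abs_of_pos hd]
    _ ≤ d * (4 * dist x y) + 4 * dist x y := by
      have h1 := abs_le.1 (hb (i - 1))
      have h2 := abs_le.1 (hb i)
      have h3 := abs_le.1 (hb (i + 1))
      gcongr
      · exact abs_le.2 ⟨by linarith, by linarith⟩
      · exact hb i
    _ = _ := by ring

theorem norm_clampedField_le {a d : ℝ} (ha : a ∈ Set.Ioo (0 : ℝ) 1) (hd : 0 < d)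
    (x : ZMod n → ℝ) : ‖clampedField a d x‖ ≤ Real.toNNReal (2 * d + 1) := by
  rw [Real.coe_toNNReal _ (by linarith)]
  refine (pi_norm_le_iff_of_nonneg (by linarith)).2 fun i => ?_
  obtain ⟨h1, h1'⟩ := clamp_mem_Icc (x (i - 1))
  obtain ⟨h2, h2'⟩ := clamp_mem_Icc (x i)
  obtain ⟨h3, h3'⟩ := clamp_mem_Icc (x (i + 1))
  have hg := abs_le.1 (abs_g_le_one ha (clamp_mem_Icc (x i)))
  unfold clampedField cycField
  rw [Real.norm_eq_abs, abs_le]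
  constructor <;> nlinarith

/-- A scalar function that cannot increase above the level `c` stays below it. -/
theorem le_of_deriv_nonpos_of_lt {y y' : ℝ → ℝ} {c : ℝ} (hy : ∀ t, HasDerivAt y (y' t) t)
    (h0 : y 0 ≤ c) (hneg : ∀ t, c < y t → y' t ≤ 0) {t : ℝ} (ht : 0 ≤ t) : y t ≤ c := by
  refine le_of_forall_pos_le_add fun ε hε => ?_
  have hpos : 0 < ε / (1 + t) := div_pos hε (by linarith)
  have h := image_le_of_deriv_right_lt_deriv_boundary (a := 0) (b := t) (f := y) (f' := y')
    (B := fun s => c + ε / (1 + t) * (1 + s)) (B' := fun _ => ε / (1 + t))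
    (fun s _ => (hy s).continuousAt.continuousWithinAt) (fun s _ => (hy s).hasDerivWithinAt)
    (by simp only [add_zero, mul_one]; linarith)
    (fun s => by
      simpa using (((hasDerivAt_id s).const_add 1).const_mul (ε / (1 + t))).const_add c)
    (fun s hs heq => (hneg s (by
      rw [heq]
      have : 0 < ε / (1 + t) * (1 + s) := mul_pos hpos (by linarith [hs.1])
      linarith)).trans_lt hpos)
    (Set.right_mem_Icc.2 ht)
  rwa [div_mul_cancel₀ _ (by linarith : (1 + t) ≠ 0)] at h

/-- Global solvability on the cycle for initial data in `[0, 1]`. -/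
theorem exists_cycle_solution {a d : ℝ} (ha : a ∈ Set.Ioo (0 : ℝ) 1) (hd : 0 < d)
    {x₀ : ZMod n → ℝ} (hx₀ : ∀ i, x₀ i ∈ Set.Icc (0 : ℝ) 1) :
    ∃ x : ℝ → ZMod n → ℝ, x 0 = x₀ ∧ ∀ t, 0 ≤ t → HasDerivAt x (cycField a d (x t)) t := by
  obtain ⟨x, h0, hx⟩ := exists_global_integralCurve (lipschitzWith_clampedField (n := n) ha hd)
    (norm_clampedField_le ha hd) x₀
  refine ⟨x, h0, fun t ht => ?_⟩
  have hcoord : ∀ (i : ZMod n) s, HasDerivAt (fun s => x s i) (clampedField a d (x s) i) s :=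
    fun i s => hasDerivAt_pi.1 (hx s) i
  have hmem : ∀ i, x t i ∈ Set.Icc (0 : ℝ) 1 := by
    intro i
    constructor
    · have h := le_of_deriv_nonpos_of_lt (y := fun s => -x s i) (c := 0)
        (fun s => (hcoord i s).neg) (by rw [h0]; linarith [(hx₀ i).1]) (fun s hs => ?_) ht
      · linarith
      · have hz : max 0 (min 1 (x s i)) = 0 :=
          max_eq_left ((min_le_right _ _).trans (by linarith))
        unfold clampedField cycField
        simp only [hz]
        have h1 := (clamp_mem_Icc (x s (i - 1))).1
        have h2 := (clamp_mem_Icc (x s (i + 1))).1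
        have hg : g a 0 = 0 := by simp [g]
        rw [hg]
        nlinarith
    · refine le_of_deriv_nonpos_of_lt (hcoord i) (by rw [h0]; exact (hx₀ i).2)
        (fun s hs => ?_) ht
      have hz : max 0 (min 1 (x s i)) = 1 := by
        rw [min_eq_left hs.le, max_eq_right zero_le_one]
      unfold clampedField cycField
      simp only [hz]
      have h1 := (clamp_mem_Icc (x s (i - 1))).2
      have h2 := (clamp_mem_Icc (x s (i + 1))).2
      have hg : g a 1 = 0 := by simp [g]
      rw [hg]
      nlinarith
  have hcl : clampedField a d (x t) = cycField a d (x t) := by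
    unfold clampedField
    congr 1
    funext i
    exact clamp_of_mem_Icc (hmem i)
  rw [← hcl]
  exact hx t

/-- Periodic sequences as elements of `ℓ^∞(ℤ; ℝ)`. -/
noncomputable def cycEmbed : (ZMod n → ℝ) →ₗ[ℝ] lp (fun _ : ℤ => ℝ) ⊤ where
  toFun x := ⟨fun i : ℤ => x (i : ZMod n), memℓp_infty ⟨‖x‖, by
    rintro _ ⟨i, rfl⟩
    exact norm_le_pi_norm x _⟩⟩
  map_add' _ _ := rfl
  map_smul' _ _ := rfl

theorem cycEmbed_apply (x : ZMod n → ℝ) (i : ℤ) : cycEmbed x i = x (i : ZMod n) := rfl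

theorem isLDESol_cycEmbed {a d : ℝ} {x : ℝ → ZMod n → ℝ}
    (hx : ∀ t, 0 ≤ t → HasDerivAt x (cycField a d (x t)) t) :
    IsLDESol a d fun t => cycEmbed (x t) := fun t ht =>
  ⟨cycEmbed (cycField a d (x t)),
    (LinearMap.toContinuousLinearMap (cycEmbed (n := n))).hasFDerivAt.comp_hasDerivAt t (hx t ht),
    fun i => by simp [cycEmbed_apply, cycField]⟩

/-- An antiderivative of the nonlinearity. -/
noncomputable def gPrimitive (a u : ℝ) : ℝ := -u ^ 4 / 4 + (1 + a) * u ^ 3 / 3 - a * u ^ 2 / 2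

theorem hasDerivAt_gPrimitive (a u : ℝ) : HasDerivAt (gPrimitive a) (g a u) u := by
  unfold gPrimitive
  have h := ((((hasDerivAt_pow 4 u).neg.div_const 4).add
    (((hasDerivAt_pow 3 u).const_mul (1 + a)).div_const 3))).sub
    (((hasDerivAt_pow 2 u).const_mul a).div_const 2)
  refine h.congr_deriv ?_
  unfold g
  push_cast
  ring

/-- The energy of which the equation on the cycle is the gradient flow. -/
noncomputable def energy (a d : ℝ) (x : ZMod n → ℝ) : ℝ :=
  ∑ i, (d / 2 * (x (i + 1) - x i) ^ 2 - gPrimitive a (x i))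

theorem sum_sub_mul_sub (x y : ZMod n → ℝ) :
    ∑ i, (x (i + 1) - x i) * (y (i + 1) - y i) =
      -∑ i, (x (i - 1) - 2 * x i + x (i + 1)) * y i := by
  have h : ∑ i, (x (i + 1) - x i) * y (i + 1) = ∑ i, (x i - x (i - 1)) * y i := by
    rw [← Equiv.sum_comp (Equiv.addRight (1 : ZMod n)) fun i => (x i - x (i - 1)) * y i]
    simp
  calc _ = ∑ i, (x (i + 1) - x i) * y (i + 1) - ∑ i, (x (i + 1) - x i) * y i := by
        rw [← Finset.sum_sub_distrib]
        exact Finset.sum_congr rfl fun i _ => by ring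
    _ = _ := by
      rw [h, ← Finset.sum_sub_distrib, ← Finset.sum_neg_distrib]
      exact Finset.sum_congr rfl fun i _ => by ring

theorem hasDerivAt_energy {a d t : ℝ} {x : ℝ → ZMod n → ℝ} {x' : ZMod n → ℝ}
    (hx : HasDerivAt x x' t) :
    HasDerivAt (fun s => energy a d (x s)) (-∑ i, cycField a d (x t) i * x' i) t := by
  have hc : ∀ i, HasDerivAt (fun s => x s i) (x' i) t := hasDerivAt_pi.1 hx
  have h := HasDerivAt.fun_sum (u := Finset.univ) fun i (_ : i ∈ Finset.univ) =>
    ((((hc (i + 1)).sub (hc i)).pow 2).const_mul (d / 2)).sub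
      ((hasDerivAt_gPrimitive a (x t i)).comp t (hc i))
  refine h.congr_deriv ?_
  have hs := sum_sub_mul_sub (x t) x'
  calc _ = d * ∑ i, (x t (i + 1) - x t i) * (x' (i + 1) - x' i) - ∑ i, g a (x t i) * x' i := by
        rw [Finset.mul_sum, ← Finset.sum_sub_distrib]
        refine Finset.sum_congr rfl fun i _ => ?_
        simp only [Pi.sub_apply]
        push_cast
        ring
    _ = _ := by
      rw [hs, mul_neg, Finset.mul_sum, ← neg_add', ← Finset.sum_add_distrib]
      congr 1
      refine Finset.sum_congr rfl fun i _ => ?_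
      unfold cycField
      ring

theorem energy_antitone {a d : ℝ} {x : ℝ → ZMod n → ℝ}
    (hx : ∀ t, 0 ≤ t → HasDerivAt x (cycField a d (x t)) t) {t : ℝ} (ht : 0 ≤ t) :
    energy a d (x t) ≤ energy a d (x 0) := by
  have hd : ∀ s ∈ Set.Ici (0 : ℝ), HasDerivAt (fun s => energy a d (x s))
      (-∑ i, cycField a d (x s) i * cycField a d (x s) i) s := fun s hs =>
    hasDerivAt_energy (hx s hs)
  refine antitoneOn_of_deriv_nonpos (convex_Ici 0)
    (fun s hs => (hd s hs).continuousAt.continuousWithinAt)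
    (fun s hs => (hd s (interior_subset hs)).differentiableAt.differentiableWithinAt)
    (fun s hs => ?_) Set.self_mem_Ici ht ht
  rw [(hd s (interior_subset hs)).deriv, neg_nonpos]
  exact Finset.sum_nonneg fun i _ => mul_self_nonneg _

theorem continuous_energy (a d : ℝ) : Continuous (energy (n := n) a d) := by
  unfold energy gPrimitive
  fun_prop

namespace SmallCoupling

variable {a d r : ℝ}

theorem gPrimitive_growth (h : SmallCoupling a d r) {u s : ℝ} (hu : |u - a| ≤ r) (hs : 0 ≤ s)
    (hsr : s ≤ r) : r * s ^ 2 ≤ gPrimitive a (u + s) - gPrimitive a u - s * g a u := by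
  obtain ⟨t, rfl⟩ : ∃ t, u = a + t := ⟨u - a, by ring⟩
  rw [add_sub_cancel_left, abs_le] at hu
  have h8 := h.eight_mul_le
  have hr := h.r_pos
  have hr1 := h.r_le
  obtain ⟨ha0, ha1⟩ := h.mem_Ioo
  have e : gPrimitive a (a + t + s) - gPrimitive a (a + t) - s * g a (a + t) =
      (a * (1 - a) / 2 + (1 - 2 * a) * (t + s / 3) - 3 / 2 * t ^ 2 - s * t - s ^ 2 / 4) *
        s ^ 2 := by
    unfold gPrimitive g
    ring
  rw [e]
  refine mul_le_mul_of_nonneg_right ?_ (sq_nonneg s)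
  have h1 : |(1 - 2 * a) * (t + s / 3)| ≤ 1 * (4 / 3 * r) := by
    rw [abs_mul]
    exact mul_le_mul (abs_le.2 ⟨by linarith, by linarith⟩) (abs_le.2 ⟨by linarith, by linarith⟩)
      (abs_nonneg _) zero_le_one
  have h2 := (abs_le.1 h1).1
  have h3 : t ^ 2 ≤ r ^ 2 := sq_le_sq' hu.1 hu.2
  have h4 : s ^ 2 ≤ r ^ 2 := pow_le_pow_left₀ hs hsr 2
  have h5 : s * t ≤ r ^ 2 := by nlinarith
  have h6 : r ^ 2 ≤ r / 32 := by nlinarith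
  linarith

/-- Raising a single coordinate close to `a` lowers the energy of a stationary solution. -/
theorem energy_perturb_lt (h : SmallCoupling a d r) {p : ZMod n → ℝ}
    (hp : ∀ i, cycField a d p i = 0) {j : ZMod n} (hj : |p j - a| ≤ r) {s : ℝ} (hs : 0 < s)
    (hsr : s ≤ r) : energy a d (p + s • Pi.single j 1) < energy a d p := by
  set e : ZMod n → ℝ := Pi.single j 1 with he
  have he01 : ∀ i, e i = 0 ∨ e i = 1 := fun i => by
    rw [he, Pi.single_apply]
    split_ifs <;> simp
  have hsum : ∀ φ : ZMod n → ℝ, ∑ i, φ i * e i = φ j := fun φ => by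
    simp [he, Pi.single_apply]
  have hsum1 : ∑ i, e i = 1 := by simpa using hsum fun _ => 1
  have hd := h.d_pos
  have hexp : energy a d (p + s • e) - energy a d p =
      d * s * ∑ i, (p (i + 1) - p i) * (e (i + 1) - e i) +
        d / 2 * s ^ 2 * ∑ i, (e (i + 1) - e i) ^ 2 -
        ∑ i, (gPrimitive a (p i + s) - gPrimitive a (p i)) * e i := by
    unfold energy
    rw [Finset.mul_sum, Finset.mul_sum, ← Finset.sum_sub_distrib, ← Finset.sum_add_distrib,
      ← Finset.sum_sub_distrib]
    refine Finset.sum_congr rfl fun i _ => ?_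
    simp only [Pi.add_apply, Pi.smul_apply, smul_eq_mul]
    rcases he01 i with hi | hi <;> rw [hi] <;> ring_nf
  have hsq : ∑ i, (e (i + 1) - e i) ^ 2 ≤ 2 := by
    have hshift : ∑ i, e (i + 1) = 1 := by
      rw [← hsum1]
      exact Equiv.sum_comp (Equiv.addRight (1 : ZMod n)) e
    calc _ ≤ ∑ i, (e (i + 1) + e i) := Finset.sum_le_sum fun i _ => by
          rcases he01 i with hi | hi <;> rcases he01 (i + 1) with hi' | hi' <;> rw [hi, hi'] <;>
            norm_num
      _ = 2 := by rw [Finset.sum_add_distrib, hshift, hsum1]; norm_num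
  have hlin : ∑ i, (p (i + 1) - p i) * (e (i + 1) - e i) =
      -(p (j - 1) - 2 * p j + p (j + 1)) := by
    rw [sum_sub_mul_sub, hsum]
  have hgrow := h.gPrimitive_growth hj hs.le hsr
  have hstat := hp j
  unfold cycField at hstat
  rw [hlin, hsum fun i => gPrimitive a (p i + s) - gPrimitive a (p i)] at hexp
  have h1 : d / 2 * s ^ 2 * ∑ i, (e (i + 1) - e i) ^ 2 ≤ d / 2 * s ^ 2 * 2 :=
    mul_le_mul_of_nonneg_left hsq (by positivity)
  have hdr : d < r := by linarith [h.d_lt, h.cube_le, h.r_pos]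
  have h2 : d * s ^ 2 < r * s ^ 2 := mul_lt_mul_of_pos_right hdr (by positivity)
  have h3 : d * s * -(p (j - 1) - 2 * p j + p (j + 1)) = s * g a (p j) := by
    linear_combination -s * hstat
  linarith

/-- A stationary solution with a coordinate close to `a` is not asymptotically stable. -/
theorem not_asympStable (h : SmallCoupling a d r) {p : ZMod n → ℝ}
    (hp : ∀ i, cycField a d p i = 0) {j : ZMod n} (hj : |p j - a| ≤ r) :
    ¬ LDEAsympStable a d (cycEmbed p) := by
  rintro ⟨-, δ, hδ, hconv⟩
  have hr := h.r_pos
  set s := min r (δ / 2) with hsdef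
  have hs : 0 < s := lt_min hr (by linarith)
  have hsr : s ≤ r := min_le_left _ _
  have hsδ : s < δ := (min_le_right _ _).trans_lt (by linarith)
  set x₀ : ZMod n → ℝ := p + s • Pi.single j 1 with hx₀
  have hpI := mem_Icc_of_stationary h.mem_Ioo h.d_pos hp
  have hx₀I : ∀ i, x₀ i ∈ Set.Icc (0 : ℝ) 1 := by
    intro i
    by_cases hij : i = j
    · subst hij
      have h1 := abs_le.1 hj
      have h2 := h.le_one_sub
      have h3 := (hpI i).1
      simp only [hx₀, Pi.add_apply, Pi.smul_apply, Pi.single_eq_same, smul_eq_mul, mul_one]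
      constructor <;> linarith
    · simpa [hx₀, Pi.single_eq_of_ne hij] using hpI i
  obtain ⟨x, hx0, hx⟩ := exists_cycle_solution h.mem_Ioo h.d_pos hx₀I
  have hstart : ‖cycEmbed (x 0) - cycEmbed p‖ < δ := by
    rw [hx0, ← map_sub, hx₀, add_sub_cancel_left]
    refine (lp.norm_le_of_forall_le hs.le fun i => ?_).trans_lt hsδ
    rw [cycEmbed_apply, Pi.smul_apply, Pi.single_apply, smul_eq_mul, Real.norm_eq_abs]
    split_ifs <;> simp [abs_of_pos hs, hs.le]
  have hlim := hconv _ (isLDESol_cycEmbed hx) hstart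
  have hlim' : Tendsto x atTop (nhds p) := by
    rw [tendsto_pi_nhds]
    intro i
    obtain ⟨k, rfl⟩ := ZMod.intCast_surjective i
    rw [tendsto_iff_norm_sub_tendsto_zero] at hlim ⊢
    refine squeeze_zero (fun t => norm_nonneg _) (fun t => ?_) hlim
    exact lp.norm_apply_le_norm ENNReal.top_ne_zero (cycEmbed (x t) - cycEmbed p) k
  have hE : Tendsto (fun t => energy a d (x t)) atTop (nhds (energy a d p)) :=
    ((continuous_energy a d).tendsto p).comp hlim'
  have hle : energy a d p ≤ energy a d (x 0) := by
    refine le_of_tendsto hE ?_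
    filter_upwards [eventually_ge_atTop 0] with t ht using energy_antitone hx ht
  rw [hx0] at hle
  exact absurd (h.energy_perturb_lt hp hj hs hsr) (not_lt.2 hle)

/-- A stationary solution in a box of wells is asymptotically stable. -/
theorem asympStable_of_mem_well (h : SmallCoupling a d r) {p : ZMod n → ℝ}
    (hp : ∀ i, cycField a d p i = 0) {w : ZMod n → Bool} (hw : ∀ i, p i ∈ well r (w i)) :
    LDEAsympStable a d (cycEmbed p) := by
  have hr := h.r_pos
  have hr1 := h.r_le
  refine asympStable_of_gSlope_le h.d_pos hr hr (M := 20) (fun i => ?_) (fun i y hy => ?_)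
    (fun i y hy => ?_)
  · have := hp (i : ZMod n)
    simpa [cycEmbed_apply, cycField] using this
  · rw [cycEmbed_apply] at hy ⊢
    have hi := hw (i : ZMod n)
    rw [abs_le] at hy
    cases hb : w (i : ZMod n) <;> rw [hb] at hi <;>
      simp only [well, Bool.false_eq_true, if_true, if_false, Set.mem_Icc] at hi
    · exact h.gSlope_le_of_abs_le (abs_le.2 ⟨by linarith, by linarith⟩)
        (abs_le.2 ⟨by linarith, by linarith⟩)
    · exact h.gSlope_le_of_abs_sub_one_le (abs_le.2 ⟨by linarith, by linarith⟩)
        (abs_le.2 ⟨by linarith, by linarith⟩)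
  · rw [cycEmbed_apply] at hy ⊢
    have hi := h.well_subset _ (hw (i : ZMod n))
    rw [abs_le] at hy
    exact neg_le_gSlope h.mem_Ioo ⟨by linarith [hi.1], by linarith [hi.2]⟩
      ⟨by linarith [hi.1], by linarith [hi.2]⟩

theorem mem_well_or_near (h : SmallCoupling a d r) {p : ZMod n → ℝ}
    (hp : ∀ i, cycField a d p i = 0) (i : ZMod n) :
    p i ∈ well r (decide (1 / 2 < p i)) ∨ |p i - a| ≤ r := by
  have hI := mem_Icc_of_stationary h.mem_Ioo h.d_pos hp
  have hr1 := h.r_le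
  have hr := h.r_pos
  have hd := h.d_pos
  have hg : |g a (p i)| ≤ 2 * d := by
    have h1 := hI (i - 1)
    have h2 := hI i
    have h3 := hI (i + 1)
    have h4 := hp i
    unfold cycField at h4
    rw [abs_le]
    constructor <;> nlinarith [h1.1, h1.2, h2.1, h2.2, h3.1, h3.2]
  rcases h.near_root_of_abs_g_le (hI i) hg with h1 | h1 | h1
  · left
    have : ¬ (1 / 2 < p i) := by linarith
    simp only [this, decide_false, well, Bool.false_eq_true, if_false]
    exact ⟨(hI i).1, h1⟩
  · exact Or.inr h1
  · left
    have : 1 / 2 < p i := by linarith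
    simp only [this, decide_true, well, if_true]
    exact ⟨h1, (hI i).2⟩

theorem decide_of_mem_well (h : SmallCoupling a d r) {b : Bool} {x : ℝ} (hx : x ∈ well r b) :
    decide (1 / 2 < x) = b := by
  have hr1 := h.r_le
  have hr := h.r_pos
  cases b <;> simp only [well, Bool.false_eq_true, if_true, if_false, Set.mem_Icc] at hx
  · exact decide_eq_false (by linarith)
  · exact decide_eq_true (by linarith)

end SmallCoupling

/-- The restriction to one period of a sequence, as a function on the cycle. -/
def cycRestrict (u : ℤ → ℝ) (j : ZMod n) : ℝ := u (j.val : ℤ)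

theorem cycRestrict_intCast {u : ℤ → ℝ} (hu : ∀ i : ℤ, u (i + n) = u i) (i : ℤ) :
    cycRestrict u (i : ZMod n) = u i := by
  have hp : Function.Periodic u n := hu
  unfold cycRestrict
  rw [ZMod.val_intCast, Int.emod_def, mul_comm]
  exact Function.Periodic.sub_int_mul_eq hp _

/-- Stable periodic stationary solutions are those whose coordinates all lie in wells. -/
theorem SmallCoupling.mem_stablePerStat_iff {a d r : ℝ} (h : SmallCoupling a d r) (u : ℤ → ℝ) :
    u ∈ StablePerStat n a d ↔ ∃ x : ZMod n → ℝ, (∀ i : ℤ, u i = x i) ∧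
      (∀ i, cycField a d x i = 0) ∧ ∀ i, x i ∈ well r (decide (1 / 2 < x i)) := by
  constructor
  · rintro ⟨hper, hstat, hstab⟩
    have hx := cycRestrict_intCast hper
    have hstat' : ∀ i, cycField a d (cycRestrict (n := n) u) i = 0 := by
      intro i
      obtain ⟨k, rfl⟩ := ZMod.intCast_surjective i
      have h1 := hx (k - 1)
      have h2 := hx (k + 1)
      push_cast at h1 h2
      unfold cycField
      rw [h1, h2, hx k]
      exact hstat k
    refine ⟨cycRestrict u, fun i => (hx i).symm, hstat', fun i => ?_⟩
    refine (h.mem_well_or_near hstat' i).resolve_right fun hi => ?_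
    exact h.not_asympStable hstat' hi (hstab _ fun k => hx k)
  · rintro ⟨x, hux, hstat, hwell⟩
    refine ⟨fun i => by simp [hux], fun i => ?_, fun p hp => ?_⟩
    · have := hstat i
      simpa [hux, cycField] using this
    · have : p = cycEmbed x := by
        ext i
        rw [hp i, hux i, cycEmbed_apply]
      rw [this]
      exact h.asympStable_of_mem_well hstat hwell

/-- The word recording which coordinates of a sequence are close to `1`. -/
noncomputable def wordOf {a d : ℝ} (u : StablePerStat n a d) (j : ZMod n) : Bool :=
  decide (1 / 2 < cycRestrict u.1 j)

theorem wordOf_intCast {a d : ℝ} (u : StablePerStat n a d) (i : ℤ) :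
    wordOf u (i : ZMod n) = decide (1 / 2 < u.1 i) := by
  unfold wordOf
  rw [cycRestrict_intCast u.2.1]

theorem SmallCoupling.bijective_wordOf {a d r : ℝ} (h : SmallCoupling a d r) :
    Function.Bijective (wordOf (n := n) (a := a) (d := d)) := by
  constructor
  · intro u v huv
    obtain ⟨x, hux, hx0, hxw⟩ := (h.mem_stablePerStat_iff u.1).1 u.2
    obtain ⟨y, hvy, hy0, hyw⟩ := (h.mem_stablePerStat_iff v.1).1 v.2
    have hw : ∀ i : ZMod n, wordOf u i = decide (1 / 2 < x i) ∧
        wordOf v i = decide (1 / 2 < y i) := by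
      intro i
      obtain ⟨k, rfl⟩ := ZMod.intCast_surjective i
      rw [wordOf_intCast, wordOf_intCast, hux, hvy]
      exact ⟨rfl, rfl⟩
    have hxy : x = y := (h.existsUnique_stationary (wordOf u)).unique
      ⟨fun i => by rw [(hw i).1]; exact hxw i, hx0⟩
      ⟨fun i => by rw [huv, (hw i).2]; exact hyw i, hy0⟩
    ext i
    rw [hux, hvy, hxy]
  · intro w
    obtain ⟨x, ⟨hxw, hx0⟩, -⟩ := h.existsUnique_stationary w
    have hdec : ∀ i, decide (1 / 2 < x i) = w i := fun i => h.decide_of_mem_well (hxw i)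
    refine ⟨⟨fun i => x i, (h.mem_stablePerStat_iff _).2
      ⟨x, fun _ => rfl, hx0, fun i => by rw [hdec i]; exact hxw i⟩⟩, ?_⟩
    funext i
    obtain ⟨k, rfl⟩ := ZMod.intCast_surjective i
    rw [wordOf_intCast]
    exact hdec _

theorem SmallCoupling.translate_mem {a d r : ℝ} (h : SmallCoupling a d r) {u : ℤ → ℝ}
    (hu : u ∈ StablePerStat n a d) (l : ℤ) : (fun i => u (i + l)) ∈ StablePerStat n a d := by
  obtain ⟨x, hux, hx0, hxw⟩ := (h.mem_stablePerStat_iff u).1 hu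
  refine (h.mem_stablePerStat_iff _).2 ⟨fun i => x (i + l), fun i => by simp [hux],
    fun i => ?_, fun i => hxw _⟩
  rw [← hx0 (i + l)]
  unfold cycField
  ring_nf

theorem SmallCoupling.reflect_mem {a d r : ℝ} (h : SmallCoupling a d r) {u : ℤ → ℝ}
    (hu : u ∈ StablePerStat n a d) : (fun i => u (1 - i)) ∈ StablePerStat n a d := by
  obtain ⟨x, hux, hx0, hxw⟩ := (h.mem_stablePerStat_iff u).1 hu
  refine (h.mem_stablePerStat_iff _).2 ⟨fun i => x (1 - i), fun i => by simp [hux],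
    fun i => ?_, fun i => hxw _⟩
  rw [← hx0 (1 - i)]
  unfold cycField
  ring_nf

/-- Translating a solution translates its word, and only the translate has the translated word. -/
theorem SmallCoupling.translate_iff_wordOf {a d r : ℝ} (h : SmallCoupling a d r)
    (u v : StablePerStat n a d) :
    (∀ i : ℤ, v.1 i = u.1 (i + 1)) ↔ ∀ j, wordOf v j = wordOf u (j + 1) := by
  have key : ∀ j, wordOf (⟨_, h.translate_mem u.2 1⟩ : StablePerStat n a d) j =
      wordOf u (j + 1) := by
    intro j
    obtain ⟨k, rfl⟩ := ZMod.intCast_surjective j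
    have := wordOf_intCast u (k + 1)
    push_cast at this
    rw [this, wordOf_intCast]
  constructor
  · intro hv j
    rw [← key j]
    congr 1
    exact Subtype.ext (funext hv)
  · intro hv
    have : v = ⟨_, h.translate_mem u.2 1⟩ :=
      h.bijective_wordOf.1 (funext fun j => (hv j).trans (key j).symm)
    intro i
    rw [this]

theorem SmallCoupling.reflect_iff_wordOf {a d r : ℝ} (h : SmallCoupling a d r)
    (u v : StablePerStat n a d) :
    (∀ i : ℤ, v.1 i = u.1 (1 - i)) ↔ ∀ j, wordOf v j = wordOf u (1 - j) := by
  have key : ∀ j, wordOf (⟨_, h.reflect_mem u.2⟩ : StablePerStat n a d) j =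
      wordOf u (1 - j) := by
    intro j
    obtain ⟨k, rfl⟩ := ZMod.intCast_surjective j
    have := wordOf_intCast u (1 - k)
    push_cast at this
    rw [this, wordOf_intCast]
  constructor
  · intro hv j
    rw [← key j]
    congr 1
    exact Subtype.ext (funext hv)
  · intro hv
    have : v = ⟨_, h.reflect_mem u.2⟩ :=
      h.bijective_wordOf.1 (funext fun j => (hv j).trans (key j).symm)
    intro i
    rw [this]

end Classification

/-- For `n ≥ 3`, `a ∈ (0,1)` and all small `d > 0`: there are exactly `2ⁿ`
asymptotically stable `n`-periodic stationary solutions of the lattice Nagumo equation,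
their set is invariant under translations and reflection, the number of translation
orbits is `N₂(n)` and the number of dihedral orbits is `B₂(n)`. -/
theorem stable_periodic_solution_orbit_count
    (n : ℕ) (hn : 3 ≤ n) (a : ℝ) (ha : a ∈ Set.Ioo (0:ℝ) 1) :
    ∃ d0 > (0:ℝ), ∀ d ∈ Set.Ioo (0:ℝ) d0,
      (StablePerStat n a d).ncard = 2 ^ n ∧
      (∀ u ∈ StablePerStat n a d, ∀ ℓ : ℤ,
        (fun i : ℤ => u (i + ℓ)) ∈ StablePerStat n a d) ∧
      (∀ u ∈ StablePerStat n a d, (fun i : ℤ => u (1 - i)) ∈ StablePerStat n a d) ∧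
      n * Nat.card (Quot (TransRelS n a d)) =
        ∑ d' ∈ n.divisors, Nat.totient d' * 2 ^ (n / d') ∧
      (Nat.card (Quot (DihRelS n a d)) : ℚ) = Bq 2 n := by
  have : NeZero n := ⟨by omega⟩
  obtain ⟨ha0, ha1⟩ := ha
  set r := min a (1 - a) / 16 with hrdef
  have hr : 0 < r := div_pos (lt_min ha0 (by linarith)) (by norm_num)
  refine ⟨r ^ 3 / 2, by positivity, fun d hd => ?_⟩
  have h : SmallCoupling a d r :=
    ⟨hr, by linarith [min_le_left a (1 - a)], by linarith [min_le_right a (1 - a)], hd.1,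
      by linarith [hd.2]⟩
  let e := Equiv.ofBijective (wordOf (n := n) (a := a) (d := d)) h.bijective_wordOf
  refine ⟨?_, fun u hu l => h.translate_mem hu l, fun u hu => h.reflect_mem hu, ?_, ?_⟩
  · rw [← Nat.card_coe_set_eq, Nat.card_congr e, Nat.card_fun]
    simp
  · rw [← card_translation_quot]
    congr 1
    exact Nat.card_congr (Quot.congr e fun u v => h.translate_iff_wordOf u v)
  · rw [← card_dihedral_quot]
    congr 1
    exact Nat.card_congr (Quot.congr e fun u v =>
      or_congr (h.translate_iff_wordOf u v) (h.reflect_iff_wordOf u v))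
end
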